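/- Let R be a Cohen–Macaulay Noetherian local ring with dualizing complex, N a Gorenstein R-module, and M a maximal Cohen–Macaulay R-module of finite Gorenstein flat dimension. Then Hom_R(M, N) is a G–Gorenstein R-module. -/

import Mathlib

universe u

namespace GG

open RingTheory.Sequence

variable (R : Type u) [CommRing R]

/-- A module `N` is Gorenstein injective if it is a kernel in a `Hom(Inj,−)`-exact exact
doubly infinite complex of injective modules. -/
def IsGorensteinInjective (N : Type u) [AddCommGroup N] [Module R N] : Prop :=
  ∃ (X : ℤ → ModuleCat.{u} R) (d : ∀ n : ℤ, X n →ₗ[R] X (n + 1)),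
    (∀ n, Module.Injective R (X n)) ∧
    (∀ n, LinearMap.range (d n) = LinearMap.ker (d (n + 1))) ∧
    (∀ (I : ModuleCat.{u} R), Module.Injective R I →
      ∀ (n : ℤ) (φ : I →ₗ[R] X (n + 1)), (d (n + 1)).comp φ = 0 →
        ∃ ψ : I →ₗ[R] X n, (d n).comp ψ = φ) ∧
    Nonempty (N ≃ₗ[R] LinearMap.ker (d 0))

/-- A module `N` is Gorenstein projective if it is a kernel in a `Hom(−,Proj)`-exact exact
doubly infinite complex of projective modules. -/
def IsGorensteinProjective (N : Type u) [AddCommGroup N] [Module R N] : Prop :=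
  ∃ (X : ℤ → ModuleCat.{u} R) (d : ∀ n : ℤ, X n →ₗ[R] X (n + 1)),
    (∀ n, Module.Projective R (X n)) ∧
    (∀ n, LinearMap.range (d n) = LinearMap.ker (d (n + 1))) ∧
    (∀ (P : ModuleCat.{u} R), Module.Projective R P →
      ∀ (n : ℤ) (φ : X (n + 1) →ₗ[R] P), φ.comp (d n) = 0 →
        ∃ ψ : X (n + 1 + 1) →ₗ[R] P, ψ.comp (d (n + 1)) = φ) ∧
    Nonempty (N ≃ₗ[R] LinearMap.ker (d 0))

/-- A module `N` is Gorenstein flat if it is a kernel in an `(Inj ⊗ −)`-exact exact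
doubly infinite complex of flat modules. -/
def IsGorensteinFlat (N : Type u) [AddCommGroup N] [Module R N] : Prop :=
  ∃ (X : ℤ → ModuleCat.{u} R) (d : ∀ n : ℤ, X n →ₗ[R] X (n + 1)),
    (∀ n, Module.Flat R (X n)) ∧
    (∀ n, LinearMap.range (d n) = LinearMap.ker (d (n + 1))) ∧
    (∀ (I : ModuleCat.{u} R), Module.Injective R I →
      ∀ n : ℤ, LinearMap.range (LinearMap.lTensor (R := R) I (d n)) =
        LinearMap.ker (LinearMap.lTensor (R := R) I (d (n + 1)))) ∧
    Nonempty (N ≃ₗ[R] LinearMap.ker (d 0))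

/-- Existence of a right resolution of length `≤ n` by modules satisfying `P`. -/
def CoresolutionLE (P : ModuleCat.{u} R → Prop) (M : Type u) [AddCommGroup M] [Module R M]
    (n : ℕ) : Prop :=
  ∃ (G : ℕ → ModuleCat.{u} R) (d : ∀ i : ℕ, G i →ₗ[R] G (i + 1)) (ε : M →ₗ[R] G 0),
    (∀ i, P (G i)) ∧ Function.Injective ε ∧
    LinearMap.range ε = LinearMap.ker (d 0) ∧
    (∀ i, LinearMap.range (d i) = LinearMap.ker (d (i + 1))) ∧
    (∀ i, n < i → ∀ x : G i, x = 0)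

/-- Existence of a left resolution of length `≤ n` by modules satisfying `P`. -/
def ResolutionLE (P : ModuleCat.{u} R → Prop) (M : Type u) [AddCommGroup M] [Module R M]
    (n : ℕ) : Prop :=
  ∃ (G : ℕ → ModuleCat.{u} R) (d : ∀ i : ℕ, G (i + 1) →ₗ[R] G i) (ε : G 0 →ₗ[R] M),
    (∀ i, P (G i)) ∧ Function.Surjective ε ∧
    LinearMap.ker ε = LinearMap.range (d 0) ∧
    (∀ i, LinearMap.ker (d i) = LinearMap.range (d (i + 1))) ∧
    (∀ i, n < i → ∀ x : G i, x = 0)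

/-- `Gid_R M ≤ n`. -/
def gidLE (M : Type u) [AddCommGroup M] [Module R M] (n : ℕ) : Prop :=
  CoresolutionLE R (fun N => IsGorensteinInjective R N) M n

/-- `id_R M ≤ n`. -/
def idLE (M : Type u) [AddCommGroup M] [Module R M] (n : ℕ) : Prop :=
  CoresolutionLE R (fun N => Module.Injective R N) M n

/-- `pd_R M ≤ n`. -/
def pdLE (M : Type u) [AddCommGroup M] [Module R M] (n : ℕ) : Prop :=
  ResolutionLE R (fun N => Module.Projective R N) M n

/-- `fd_R M ≤ n`. -/
def fdLE (M : Type u) [AddCommGroup M] [Module R M] (n : ℕ) : Prop :=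
  ResolutionLE R (fun N => Module.Flat R N) M n

/-- `Gfd_R M ≤ n`. -/
def gfdLE (M : Type u) [AddCommGroup M] [Module R M] (n : ℕ) : Prop :=
  ResolutionLE R (fun N => IsGorensteinFlat R N) M n

/-- Gorenstein injective dimension, as an extended natural number. -/
noncomputable def gid (M : Type u) [AddCommGroup M] [Module R M] : ℕ∞ :=
  sInf {c : ℕ∞ | ∃ n : ℕ, c = n ∧ gidLE R M n}

/-- The depth of a module over a local ring: the supremum of the lengths of regular
sequences contained in the maximal ideal. -/
noncomputable def mdepth [IsLocalRing R] (M : Type u) [AddCommGroup M] [Module R M] : ℕ∞ :=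
  sSup {c : ℕ∞ | ∃ rs : List R, c = rs.length ∧
    (∀ r ∈ rs, r ∈ IsLocalRing.maximalIdeal R) ∧ RingTheory.Sequence.IsRegular M rs}

/-- The Krull dimension of a module: the Krull dimension of its support. -/
noncomputable def mdim (M : Type u) [AddCommGroup M] [Module R M] : WithBot ℕ∞ :=
  Order.krullDim ↥(Module.support R M)

/-- The height of a prime in the support of `M`. -/
noncomputable def htM (M : Type u) [AddCommGroup M] [Module R M] (p : PrimeSpectrum R) : ℕ∞ :=
  ⨆ h : p ∈ Module.support R M, Order.height (⟨p, h⟩ : ↥(Module.support R M))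

/-- A Cohen–Macaulay module over a local ring: depth equals Krull dimension. -/
def IsCMModule [IsLocalRing R] (M : Type u) [AddCommGroup M] [Module R M] : Prop :=
  (mdepth R M : WithBot ℕ∞) = mdim R M

/-- A maximal Cohen–Macaulay module over a local ring. -/
def IsMaximalCM [IsLocalRing R] (M : Type u) [AddCommGroup M] [Module R M] : Prop :=
  IsCMModule R M ∧ mdim R M = ringKrullDim R

/-- A Cohen–Macaulay local ring. -/
def IsCMLocalRing [IsLocalRing R] : Prop :=
  (mdepth R R : WithBot ℕ∞) = ringKrullDim R

/-- A Gorenstein local ring: a Noetherian local ring of finite self-injective dimension. -/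
def IsGorensteinLocalRing [IsLocalRing R] : Prop :=
  IsNoetherianRing R ∧ ∃ n : ℕ, idLE R R n

/-- A regular local ring: Noetherian, and the maximal ideal is generated by `dim R` elements. -/
def IsRegularLocal [IsLocalRing R] : Prop :=
  IsNoetherianRing R ∧ ∃ s : Finset R, Ideal.span (s : Set R) = IsLocalRing.maximalIdeal R ∧
    (s.card : WithBot ℕ∞) = ringKrullDim R

/-- A (not necessarily local) Gorenstein ring: all localizations at primes are Gorenstein. -/
def IsGorensteinRing : Prop :=
  ∀ p : PrimeSpectrum R, ∃ n : ℕ,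
    idLE (Localization.AtPrime p.asIdeal) (Localization.AtPrime p.asIdeal) n

/-- `R` admits a dualizing complex; by Kawasaki's theorem this is equivalent to being a
homomorphic image of a finite-dimensional Gorenstein ring. -/
def HasDualizingComplex : Prop :=
  ∃ Q : CommRingCat.{u}, IsNoetherianRing Q ∧ ringKrullDim Q < ⊤ ∧ IsGorensteinRing Q ∧
    ∃ f : Q →+* R, Function.Surjective f

section Cousin

/-- The product of the localizations of `N` at the primes in `S`. -/
noncomputable abbrev locProd (S : Set (PrimeSpectrum R)) (N : Type u) [AddCommGroup N]
    [Module R N] : Type u :=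
  Π p : S, LocalizedModule p.1.asIdeal.primeCompl N

/-- The submodule of the product of localizations consisting of finitely supported families;
this is the direct sum `⊕_{p ∈ S} N_p`. -/
noncomputable def finSupp (S : Set (PrimeSpectrum R)) (N : Type u) [AddCommGroup N]
    [Module R N] : Submodule R (locProd R S N) where
  carrier := {f | {p : S | f p ≠ 0}.Finite}
  add_mem' := by
    intro f g hf hg
    refine (hf.union hg).subset ?_
    intro p hp
    by_contra h
    simp only [Set.mem_union, Set.mem_setOf_eq, not_or, not_not] at h
    exact hp (by simp [Pi.add_apply, h.1, h.2])
  zero_mem' := by simp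
  smul_mem' := by
    intro c f hf
    refine hf.subset ?_
    intro p hp
    by_contra h
    simp only [Set.mem_setOf_eq, not_not] at h
    exact hp (by simp [Pi.smul_apply, h])

/-- The canonical map `N → ∏_{p ∈ S} N_p`. -/
noncomputable def thetaFull (S : Set (PrimeSpectrum R)) (N : Type u) [AddCommGroup N]
    [Module R N] : N →ₗ[R] locProd R S N :=
  LinearMap.pi fun p => LocalizedModule.mkLinearMap p.1.asIdeal.primeCompl N

/-- The cokernel of `N → ⊕_{p ∈ S} N_p` (computed inside the direct sum). -/
noncomputable abbrev nextKType (S : Set (PrimeSpectrum R)) (N : Type u) [AddCommGroup N]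
    [Module R N] : Type u :=
  ↥(finSupp R S N) ⧸
    (Submodule.comap (finSupp R S N).subtype (LinearMap.range (thetaFull R S N)))

/-- The sequence of "kernel/cokernel" modules in the inductive construction
of the Cousin complex of `M` with respect to the filtration `F`. -/
noncomputable def cousinK (F : ℕ → Set (PrimeSpectrum R)) (M : ModuleCat.{u} R) :
    ℕ → ModuleCat.{u} R
  | 0 => M
  | n + 1 => ModuleCat.of R (nextKType R (F n \ F (n + 1)) (cousinK F M n))

/-- The `n`-th term `M^n = ⊕_{p ∈ ∂F_n} (coker d^{n-2})_p` of the Cousin complex. -/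
noncomputable abbrev cousinC (F : ℕ → Set (PrimeSpectrum R)) (M : ModuleCat.{u} R) (n : ℕ) :
    Type u :=
  ↥(finSupp R (F n \ F (n + 1)) (cousinK R F M n))

/-- The canonical map from the `n`-th cokernel into the product of its localizations. -/
noncomputable def cousinTheta (F : ℕ → Set (PrimeSpectrum R)) (M : ModuleCat.{u} R) (n : ℕ) :
    (cousinK R F M n) →ₗ[R] locProd R (F n \ F (n + 1)) (cousinK R F M n) :=
  thetaFull R _ _

/-- The (full) `n`-th differential of the Cousin complex, from `M^n` to the product at
level `n+1` (it lands inside the direct sum `M^{n+1}`). -/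
noncomputable def cousinD (F : ℕ → Set (PrimeSpectrum R)) (M : ModuleCat.{u} R) (n : ℕ) :
    (cousinC R F M n) →ₗ[R] locProd R (F (n + 1) \ F (n + 2)) (cousinK R F M (n + 1)) :=
  (cousinTheta R F M (n + 1)).comp
    (Submodule.mkQ (Submodule.comap (finSupp R (F n \ F (n + 1)) (cousinK R F M n)).subtype
      (LinearMap.range (thetaFull R (F n \ F (n + 1)) (cousinK R F M n)))))

/-- `F` is a filtration of `Spec R`: descending, and every element of `∂F_n = F_n \ F_{n+1}`
is a minimal member of `F_n`. -/
def IsFiltration (F : ℕ → Set (PrimeSpectrum R)) : Prop :=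
  (∀ n, F (n + 1) ⊆ F n) ∧
    ∀ n, ∀ p ∈ F n \ F (n + 1), ∀ q ∈ F n, q ≤ p → q = p

/-- The filtration `F` admits `M`. -/
def Admits (F : ℕ → Set (PrimeSpectrum R)) (M : Type u) [AddCommGroup M] [Module R M] : Prop :=
  Module.support R M ⊆ F 0

/-- The `M`-height filtration `K_i = {p ∈ Supp M | ht_M p ≥ i}`. -/
noncomputable def heightFiltration (M : Type u) [AddCommGroup M] [Module R M] :
    ℕ → Set (PrimeSpectrum R) :=
  fun i => {p | p ∈ Module.support R M ∧ (i : ℕ∞) ≤ htM R M p}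

/-- The Cousin complex `C(F, M)` is exact at `M, M⁰, …, M^t`
(together with the well-definedness of the differentials into the direct sums). -/
def CousinPartiallyExact (F : ℕ → Set (PrimeSpectrum R)) (M : ModuleCat.{u} R) (t : ℕ) : Prop :=
  (∀ n, LinearMap.range (cousinTheta R F M n) ≤ finSupp R (F n \ F (n + 1)) (cousinK R F M n)) ∧
  Function.Injective (cousinTheta R F M 0) ∧
  (∀ n ≤ t, LinearMap.ker (cousinD R F M n) =
    Submodule.comap (finSupp R (F n \ F (n + 1)) (cousinK R F M n)).subtype
      (LinearMap.range (cousinTheta R F M n)))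

/-- The Cousin complex `C(F, M)` is exact and all of its terms satisfy `P`, i.e. it provides
a `P`-resolution of `M`. -/
def CousinResolves (F : ℕ → Set (PrimeSpectrum R)) (M : ModuleCat.{u} R)
    (P : ModuleCat.{u} R → Prop) : Prop :=
  (∀ n, LinearMap.range (cousinTheta R F M n) ≤ finSupp R (F n \ F (n + 1)) (cousinK R F M n)) ∧
  Function.Injective (cousinTheta R F M 0) ∧
  (∀ n, LinearMap.ker (cousinD R F M n) =
    Submodule.comap (finSupp R (F n \ F (n + 1)) (cousinK R F M n)).subtype
      (LinearMap.range (cousinTheta R F M n))) ∧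
  (∀ n, P (ModuleCat.of R (cousinC R F M n)))

/-- A G–Gorenstein module: a nonzero finitely generated module whose Cousin complex with
respect to the `M`-height filtration is a Gorenstein injective resolution. -/
def IsGGorenstein (M : ModuleCat.{u} R) : Prop :=
  (∃ x : M, x ≠ 0) ∧ Module.Finite R M ∧
    CousinResolves R (heightFiltration R M) M (fun N => IsGorensteinInjective R N)

/-- A Gorenstein module: a nonzero finitely generated module whose Cousin complex with
respect to the `M`-height filtration is an injective resolution. -/
def IsGorensteinModule (M : ModuleCat.{u} R) : Prop :=
  (∃ x : M, x ≠ 0) ∧ Module.Finite R M ∧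
    CousinResolves R (heightFiltration R M) M (fun N => Module.Injective R N)

end Cousin

/-- A system of parameters of a local ring. -/
def IsSOP [IsLocalRing R] (rs : List R) : Prop :=
  (rs.length : WithBot ℕ∞) = ringKrullDim R ∧
    (∀ r ∈ rs, r ∈ IsLocalRing.maximalIdeal R) ∧
    IsLocalRing.maximalIdeal R ≤ (Ideal.span {r | r ∈ rs}).radical

/-- A balanced big Cohen–Macaulay module: every system of parameters of `R` is a regular
sequence on `M`. -/
def IsBalancedBigCM [IsLocalRing R] (M : Type u) [AddCommGroup M] [Module R M] : Prop :=
  ∀ rs : List R, IsSOP R rs → RingTheory.Sequence.IsRegular M rs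

end GG


namespace GP

open CategoryTheory Abelian

/-- Short exact sequence of modules. -/
structure SES {R : Type u} [CommRing R] {A B C : Type u} [AddCommGroup A] [Module R A]
    [AddCommGroup B] [Module R B] [AddCommGroup C] [Module R C]
    (f : A →ₗ[R] B) (g : B →ₗ[R] C) : Prop where
  inj : Function.Injective f
  exact : Function.Exact f g
  surj : Function.Surjective g

/-- Vanishing of `Ext`. -/
def EV (R : Type u) [CommRing R] (A B : Type u) [AddCommGroup A] [Module R A]
    [AddCommGroup B] [Module R B] (i : ℕ) : Prop :=
  Subsingleton (Ext (ModuleCat.of R A) (ModuleCat.of R B) i)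

section
variable {R : Type u} [CommRing R] {A B C X Y : Type u} [AddCommGroup A] [Module R A]
    [AddCommGroup B] [Module R B] [AddCommGroup C] [Module R C]
    [AddCommGroup X] [Module R X] [AddCommGroup Y] [Module R Y]
    {f : A →ₗ[R] B} {g : B →ₗ[R] C}

theorem EV.eq_zero {i : ℕ} (h : EV R A B i) (x : Ext (ModuleCat.of R A) (ModuleCat.of R B) i) :
    x = 0 := by
  have : Subsingleton (Ext (ModuleCat.of R A) (ModuleCat.of R B) i) := h
  exact Subsingleton.elim _ _

theorem EV.mk' {i : ℕ} (h : ∀ x : Ext (ModuleCat.of R A) (ModuleCat.of R B) i, x = 0) :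
    EV R A B i := ⟨fun a b => by rw [h a, h b]⟩

/-- associated short complex -/
abbrev SES.sc (h : SES f g) : ShortComplex (ModuleCat.{u} R) :=
  ShortComplex.moduleCatMk f g h.exact.linearMap_comp_eq_zero

theorem SES.se (h : SES f g) : h.sc.ShortExact :=
  ModuleCat.shortComplex_shortExact _ h.exact h.inj h.surj


theorem SES.cov2 (h : SES f g) {i : ℕ} (h1 : EV R X A i) (h3 : EV R X C i) : EV R X B i :=
  EV.mk' fun x => by
    obtain ⟨y, rfl⟩ := Ext.covariant_sequence_exact₂ (ModuleCat.of R X) h.se x (h3.eq_zero _)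
    have hy : y = 0 := h1.eq_zero y
    rw [hy, Ext.zero_comp]; rfl

theorem SES.cov3 (h : SES f g) {i : ℕ} (h2 : EV R X B i) (h1 : EV R X A (i+1)) : EV R X C i :=
  EV.mk' fun x => by
    obtain ⟨y, rfl⟩ := Ext.covariant_sequence_exact₃ (ModuleCat.of R X) h.se x rfl (h1.eq_zero _)
    have hy : y = 0 := h2.eq_zero y
    rw [hy, Ext.zero_comp]; rfl

theorem SES.cov1 (h : SES f g) {i : ℕ} (h3 : EV R X C i) (h2 : EV R X B (i+1)) :
    EV R X A (i+1) :=
  EV.mk' fun x => by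
    obtain ⟨y, rfl⟩ := Ext.covariant_sequence_exact₁ (ModuleCat.of R X) h.se x (h2.eq_zero _) rfl
    have hy : y = 0 := h3.eq_zero y
    rw [hy, Ext.zero_comp]; rfl

theorem SES.con2 (h : SES f g) {i : ℕ} (h1 : EV R A Y i) (h3 : EV R C Y i) : EV R B Y i :=
  EV.mk' fun x => by
    obtain ⟨y, rfl⟩ := Ext.contravariant_sequence_exact₂ h.se (ModuleCat.of R Y) x (h1.eq_zero _)
    have hy : y = 0 := h3.eq_zero y
    rw [hy, Ext.comp_zero]; rfl

theorem SES.con1 (h : SES f g) {i : ℕ} (h2 : EV R B Y i) (h3 : EV R C Y (i+1)) : EV R A Y i :=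
  EV.mk' fun x => by
    obtain ⟨y, rfl⟩ := Ext.contravariant_sequence_exact₁ h.se (ModuleCat.of R Y) x
      (add_comm 1 i) (h3.eq_zero _)
    have hy : y = 0 := h2.eq_zero y
    rw [hy, Ext.comp_zero]; rfl

theorem SES.con3 (h : SES f g) {i : ℕ} (h1 : EV R A Y i) (h2 : EV R B Y (i+1)) :
    EV R C Y (i+1) :=
  EV.mk' fun x => by
    obtain ⟨y, rfl⟩ := Ext.contravariant_sequence_exact₃ h.se (ModuleCat.of R Y) x
      (h2.eq_zero _) (add_comm 1 i)
    have hy : y = 0 := h1.eq_zero y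
    rw [hy, Ext.comp_zero]; rfl

theorem EV.of_inj [Module.Injective R Y] {i : ℕ} (hi : 0 < i) : EV R X Y i := by
  obtain ⟨j, rfl⟩ := Nat.exists_eq_succ_of_ne_zero hi.ne'
  have : CategoryTheory.Injective (ModuleCat.of R Y) :=
    Module.injective_object_of_injective_module R Y
  exact EV.mk' fun x => Ext.eq_zero_of_injective x

theorem EV.of_proj [Module.Projective R X] {i : ℕ} (hi : 0 < i) : EV R X Y i := by
  obtain ⟨j, rfl⟩ := Nat.exists_eq_succ_of_ne_zero hi.ne'
  have : CategoryTheory.Projective (ModuleCat.of R X) :=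
    (IsProjective.iff_projective X).mp inferInstance
  exact EV.mk' fun x => Ext.eq_zero_of_projective x

theorem SES.of_equiv_left (e : A ≃ₗ[R] B) : SES (e : A →ₗ[R] B) (0 : B →ₗ[R] PUnit.{u+1}) :=
  ⟨e.injective, fun x => by simp, fun x => ⟨0, rfl⟩⟩

theorem EV.of_sub_left [Subsingleton X] {i : ℕ} : EV R X Y i := by
  refine EV.mk' fun x => ?_
  have h : (𝟙 (ModuleCat.of R X)) = 0 := by ext a; exact Subsingleton.elim (α := X) _ _
  rw [← Ext.mk₀_id_comp x, h, Ext.mk₀_zero, Ext.zero_comp]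

theorem EV.of_sub_right [Subsingleton Y] {i : ℕ} : EV R X Y i := by
  refine EV.mk' fun x => ?_
  have h : (𝟙 (ModuleCat.of R Y)) = 0 := by ext a; exact Subsingleton.elim (α := Y) _ _
  rw [← Ext.comp_mk₀_id x, h, Ext.mk₀_zero, Ext.comp_zero]

theorem EV.congr_left (e : A ≃ₗ[R] B) {i : ℕ} (h : EV R A Y i) : EV R B Y i :=
  (SES.of_equiv_left e).con2 h EV.of_sub_left

theorem EV.congr_right (e : A ≃ₗ[R] B) {i : ℕ} (h : EV R X A i) : EV R X B i :=
  (SES.of_equiv_left e).cov2 h EV.of_sub_right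

/-- degree zero -/
theorem EV.zero_iff : EV R A B 0 ↔ ∀ φ : A →ₗ[R] B, φ = 0 := by
  constructor
  · intro h φ
    have := h.eq_zero (Ext.mk₀ (ModuleCat.ofHom φ))
    rw [← Ext.mk₀_zero] at this
    have := (Ext.mk₀_bijective _ _).1 this
    exact congrArg ModuleCat.Hom.hom this
  · intro h
    refine EV.mk' fun x => ?_
    obtain ⟨φ, rfl⟩ := (Ext.mk₀_bijective _ _).2 x
    have : φ = 0 := by ext1; exact h φ.hom
    rw [this, Ext.mk₀_zero]

theorem SES.lift (h : SES f g) (h1 : EV R X A 1) (φ : X →ₗ[R] C) :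
    ∃ ψ : X →ₗ[R] B, g ∘ₗ ψ = φ := by
  obtain ⟨y, hy⟩ := Ext.covariant_sequence_exact₃ (ModuleCat.of R X) h.se
    (Ext.mk₀ (ModuleCat.ofHom φ)) rfl (h1.eq_zero _)
  obtain ⟨ψ, rfl⟩ := (Ext.mk₀_bijective _ _).2 y
  rw [Ext.mk₀_comp_mk₀] at hy
  have := (Ext.mk₀_bijective _ _).1 hy
  exact ⟨ψ.hom, congrArg ModuleCat.Hom.hom this⟩

theorem SES.ext (h : SES f g) (h1 : EV R C Y 1) (φ : A →ₗ[R] Y) :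
    ∃ ψ : B →ₗ[R] Y, ψ ∘ₗ f = φ := by
  obtain ⟨y, hy⟩ := Ext.contravariant_sequence_exact₁ h.se (ModuleCat.of R Y)
    (Ext.mk₀ (ModuleCat.ofHom φ)) rfl (h1.eq_zero _)
  obtain ⟨ψ, rfl⟩ := (Ext.mk₀_bijective _ _).2 y
  rw [Ext.mk₀_comp_mk₀] at hy
  have := (Ext.mk₀_bijective _ _).1 hy
  exact ⟨ψ.hom, congrArg ModuleCat.Hom.hom this⟩

theorem SES.ev1_of_lift (h : SES f g) (h2 : EV R X B 1)
    (hl : ∀ φ : X →ₗ[R] C, ∃ ψ : X →ₗ[R] B, g ∘ₗ ψ = φ) : EV R X A 1 :=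
  EV.mk' fun x => by
    obtain ⟨y, rfl⟩ := Ext.covariant_sequence_exact₁ (ModuleCat.of R X) h.se x
      (h2.eq_zero _) (n₀ := 0) rfl
    obtain ⟨φ, rfl⟩ := (Ext.mk₀_bijective _ _).2 y
    obtain ⟨ψ, hψ⟩ := hl φ.hom
    let ψ' : ModuleCat.of R X ⟶ h.sc.X₂ := ModuleCat.ofHom ψ
    have : φ = ψ' ≫ h.sc.g := by
      ext1; exact hψ.symm
    rw [this, ← Ext.mk₀_comp_mk₀, Ext.comp_assoc_of_second_deg_zero, h.se.comp_extClass,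
      Ext.comp_zero]; rfl

theorem SES.ev1_of_ext (h : SES f g) (h2 : EV R B Y 1)
    (hl : ∀ φ : A →ₗ[R] Y, ∃ ψ : B →ₗ[R] Y, ψ ∘ₗ f = φ) : EV R C Y 1 :=
  EV.mk' fun x => by
    obtain ⟨y, rfl⟩ := Ext.contravariant_sequence_exact₃ h.se (ModuleCat.of R Y) x
      (h2.eq_zero _) (n₀ := 0) rfl
    obtain ⟨φ, rfl⟩ := (Ext.mk₀_bijective _ _).2 y
    obtain ⟨ψ, hψ⟩ := hl φ.hom
    let ψ' : h.sc.X₂ ⟶ ModuleCat.of R Y := ModuleCat.ofHom ψ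
    have : φ = h.sc.f ≫ ψ' := by
      ext1; exact hψ.symm
    rw [this, ← Ext.mk₀_comp_mk₀, ← Ext.comp_assoc _ _ _ (add_zero 1) (zero_add 0) rfl,
      h.se.extClass_comp, Ext.zero_comp]; rfl

theorem inj_of_ev1 (h : ∀ (X : Type u) [AddCommGroup X] [Module R X], EV R X Y 1) :
    Module.Injective R Y := by
  constructor
  intro X X' _ _ _ _ i hi φ
  have hs : SES i (LinearMap.range i).mkQ :=
    ⟨hi, LinearMap.exact_map_mkQ_range i, Submodule.mkQ_surjective _⟩
  obtain ⟨ψ, hψ⟩ := hs.ext (h _) φ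
  exact ⟨ψ, fun x => LinearMap.congr_fun hψ x⟩

variable (R) in
theorem exists_inj (A : Type u) [AddCommGroup A] [Module R A] :
    ∃ (J : ModuleCat.{u} R) (C : ModuleCat.{u} R) (f : A →ₗ[R] J) (g : J →ₗ[R] C),
      Module.Injective R J ∧ SES f g := by
  obtain ⟨P⟩ := EnoughInjectives.presentation (ModuleCat.of R A)
  refine ⟨P.J, ModuleCat.of R (P.J ⧸ LinearMap.range P.f.hom), P.f.hom, Submodule.mkQ _, ?_, ?_⟩
  · have := P.injective
    exact Module.injective_module_of_injective_object R P.J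
  · exact ⟨(ModuleCat.mono_iff_injective _).1 P.mono, LinearMap.exact_map_mkQ_range _,
      Submodule.mkQ_surjective _⟩

variable (R) in
theorem exists_proj (A : Type u) [AddCommGroup A] [Module R A] :
    ∃ (J : ModuleCat.{u} R) (C : ModuleCat.{u} R) (f : C →ₗ[R] J) (g : J →ₗ[R] A),
      Module.Projective R J ∧ SES f g := by
  let g : (A →₀ R) →ₗ[R] A := Finsupp.linearCombination R id
  refine ⟨ModuleCat.of R (A →₀ R), ModuleCat.of R (LinearMap.ker g), Submodule.subtype _, g, ?_, ?_⟩
  · exact inferInstanceAs (Module.Projective R (A →₀ R))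
  · exact ⟨Subtype.val_injective, g.exact_subtype_ker_map,
      Finsupp.linearCombination_id_surjective R A⟩

theorem sub_of_smul_surj [IsLocalRing R] {E : Type*} [AddCommGroup E] [Module R E]
    [Module.Finite R E] {x : R} (hx : x ∈ IsLocalRing.maximalIdeal R)
    (h : ∀ e : E, ∃ e' : E, x • e' = e) : Subsingleton E := by
  have h1 : (⊤ : Submodule R E) = ⊥ := by
    refine Submodule.eq_bot_of_le_smul_of_le_jacobson_bot (IsLocalRing.maximalIdeal R) ⊤
      Module.Finite.fg_top ?_ (IsLocalRing.maximalIdeal_le_jacobson _)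
    intro e _
    obtain ⟨e', rfl⟩ := h e
    exact Submodule.smul_mem_smul hx trivial
  exact (Submodule.subsingleton_iff R).1 (subsingleton_of_bot_eq_top h1.symm)

theorem SES.nak_left [IsLocalRing R] [IsNoetherianRing R] [Module.Finite R A] [Module.Finite R Y]
    {x : R} (hx : x ∈ IsLocalRing.maximalIdeal R) {g : A →ₗ[R] C}
    (h : SES (x • (LinearMap.id : A →ₗ[R] A)) g) {i : ℕ} (h3 : EV R C Y (i+1)) : EV R A Y i := by
  have : Module.Finite R (Ext (ModuleCat.of R A) (ModuleCat.of R Y) i) := inferInstance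
  refine sub_of_smul_surj hx fun e => ?_
  obtain ⟨y, hy⟩ := Ext.contravariant_sequence_exact₁ h.se (ModuleCat.of R Y) e
      (add_comm 1 i) (h3.eq_zero _)
  refine ⟨y, ?_⟩
  rw [← hy]
  have : h.sc.f = x • (𝟙 (ModuleCat.of R A)) := rfl
  rw [this]
  erw [Ext.mk₀_smul, Ext.smul_comp, Ext.mk₀_id_comp]; rfl

theorem SES.nak_right [IsLocalRing R] [IsNoetherianRing R] [Module.Finite R B] [Module.Finite R X]
    {x : R} (hx : x ∈ IsLocalRing.maximalIdeal R) {g : B →ₗ[R] C}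
    (h : SES (x • (LinearMap.id : B →ₗ[R] B)) g) {i : ℕ} (h3 : EV R X C i) : EV R X B i := by
  have : Module.Finite R (Ext (ModuleCat.of R X) (ModuleCat.of R B) i) := inferInstance
  refine sub_of_smul_surj hx fun e => ?_
  obtain ⟨y, hy⟩ := Ext.covariant_sequence_exact₂ (ModuleCat.of R X) h.se e (h3.eq_zero _)
  refine ⟨y, ?_⟩
  rw [← hy]
  have : h.sc.f = x • (𝟙 (ModuleCat.of R B)) := rfl
  rw [this]
  erw [Ext.mk₀_smul, Ext.comp_smul, Ext.comp_mk₀_id]; rfl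

open scoped Pointwise in
/-- Multiplication by a regular element. -/
theorem SES.smul_of_reg {x : R} (h : IsSMulRegular A x) :
    SES (x • (LinearMap.id : A →ₗ[R] A)) (Submodule.mkQ (x • (⊤ : Submodule R A))) := by
  refine ⟨fun a b hab => h (by simpa using hab), ?_, Submodule.mkQ_surjective _⟩
  intro a
  simp only [Submodule.mkQ_apply, Submodule.Quotient.mk_eq_zero, Set.mem_range,
    LinearMap.smul_apply, LinearMap.id_apply, Submodule.mem_smul_pointwise_iff_exists]
  simp

end
end GP


namespace GP

open TensorProduct

/-- Vanishing of `Ext` in positive degrees. -/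
def EVp (R : Type u) [CommRing R] (A B : Type u) [AddCommGroup A] [Module R A]
    [AddCommGroup B] [Module R B] : Prop := ∀ i : ℕ, 0 < i → EV R A B i

/-- Finite injective dimension. -/
def FID (R : Type u) [CommRing R] (n : ℕ) (B : Type u) [AddCommGroup B] [Module R B] : Prop :=
  ∀ A : ModuleCat.{u} R, ∀ i : ℕ, n < i → EV R A B i

/-- Finite projective dimension. -/
def FPD (R : Type u) [CommRing R] (n : ℕ) (A : Type u) [AddCommGroup A] [Module R A] : Prop :=
  ∀ B : ModuleCat.{u} R, ∀ i : ℕ, n < i → EV R A B i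

/-- closed under left steps -/
def Good (R : Type u) [CommRing R] (P : ModuleCat.{u} R → Prop) : Prop :=
  ∀ Y : ModuleCat.{u} R, P Y → (∀ I : ModuleCat.{u} R, Module.Injective R I → EVp R I Y) ∧
    ∃ (K J : ModuleCat.{u} R) (f : K →ₗ[R] J) (g : J →ₗ[R] Y),
      Module.Injective R J ∧ SES f g ∧ P K

/-- coinductive version of Gorenstein injectivity -/
def LGI (R : Type u) [CommRing R] (H : Type u) [AddCommGroup H] [Module R H] : Prop :=
  ∃ P, Good R P ∧ P (ModuleCat.of R H)

section
variable {R : Type u} [CommRing R] {A B C X Y : Type u} [AddCommGroup A] [Module R A]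
    [AddCommGroup B] [Module R B] [AddCommGroup C] [Module R C]
    [AddCommGroup X] [Module R X] [AddCommGroup Y] [Module R Y]
    {f : A →ₗ[R] B} {g : B →ₗ[R] C}

theorem good_LGI : Good R (fun Y => LGI R Y) := by
  rintro Y ⟨P, hP, hY⟩
  obtain ⟨h1, K, J, f, g, hJ, hs, hK⟩ := hP _ hY
  exact ⟨h1, K, J, f, g, hJ, hs, P, hP, hK⟩

theorem LGI.ev (h : LGI R A) (I : Type u) [AddCommGroup I] [Module R I]
    (hI : Module.Injective R I) : EVp R I A :=
  (good_LGI (ModuleCat.of R A) h).1 (ModuleCat.of R I) hI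

theorem LGI.right (hs : SES f g) (hB : Module.Injective R B) (hA : LGI R A) : LGI R C := by
  refine ⟨fun Y => LGI R Y ∨ Y = ModuleCat.of R C, ?_, Or.inr rfl⟩
  rintro Y (hY | rfl)
  · obtain ⟨h1, K, J, f, g, hJ, hs, hK⟩ := good_LGI _ hY
    exact ⟨h1, K, J, f, g, hJ, hs, Or.inl hK⟩
  · refine ⟨fun I hI i hi => ?_, ModuleCat.of R A, ModuleCat.of R B, f, g, hB, hs, Or.inl hA⟩
    exact hs.cov3 (EV.of_inj hi) (hA.ev I hI _ (by omega))

theorem SES.comp_equiv (hs : SES f g) (e : C ≃ₗ[R] X) : SES f (e.toLinearMap ∘ₗ g) :=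
  ⟨hs.inj, fun x => by simp [← hs.exact x], by simpa using hs.surj⟩

theorem SES.equiv_comp (hs : SES f g) (e : X ≃ₗ[R] A) : SES (f ∘ₗ e.toLinearMap) g :=
  ⟨by simpa using hs.inj, fun x => by
    rw [hs.exact x]
    constructor
    · rintro ⟨y, rfl⟩; exact ⟨e.symm y, by simp⟩
    · rintro ⟨y, rfl⟩; exact ⟨e y, by simp⟩, hs.surj⟩

theorem LGI.congr (e : A ≃ₗ[R] B) (h : LGI R A) : LGI R B := by
  obtain ⟨h1, K, J, f, g, hJ, hs, hK⟩ := good_LGI (ModuleCat.of R A) h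
  exact LGI.right (hs.comp_equiv e) hJ hK

/-- kernel of a short exact sequence -/
noncomputable def SES.kerEquiv (hs : SES f g) : A ≃ₗ[R] LinearMap.ker g :=
  (LinearEquiv.ofInjective f hs.inj).trans
    (LinearEquiv.ofEq _ _ (LinearMap.exact_iff.1 hs.exact).symm)

theorem SES.coe_kerEquiv (hs : SES f g) (a : A) : (hs.kerEquiv a : B) = f a := rfl

theorem SES.ker (hg : Function.Surjective g) : SES (LinearMap.ker g).subtype g :=
  ⟨Subtype.val_injective, g.exact_subtype_ker_map, hg⟩

theorem LGI.left (h : LGI R A) : ∃ (J : ModuleCat.{u} R) (g : J →ₗ[R] A),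
    Module.Injective R J ∧ Function.Surjective g ∧ LGI R (LinearMap.ker g) := by
  obtain ⟨h1, K, J, f, g, hJ, hs, hK⟩ := good_LGI (ModuleCat.of R A) h
  exact ⟨J, g, hJ, hs.surj, LGI.congr hs.kerEquiv hK⟩

theorem LGI.extension (hs : SES f g) (hA : LGI R A) (hC : LGI R C) : LGI R B := by
  refine ⟨fun B => ∃ (A C : ModuleCat.{u} R) (f : A →ₗ[R] B) (g : B →ₗ[R] C), SES f g ∧ LGI R A ∧
    LGI R C, ?_, ModuleCat.of R A, ModuleCat.of R C, f, g, hs, hA, hC⟩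
  clear hs hA hC
  rintro B ⟨A, C, f, g, hs, hA, hC⟩
  refine ⟨fun I hI i hi => hs.cov2 (hA.ev I hI i hi) (hC.ev I hI i hi), ?_⟩
  obtain ⟨JA, gA, hJA, sA, kA⟩ := hA.left
  obtain ⟨JC, gC, hJC, sC, kC⟩ := hC.left
  obtain ⟨γ, hγ⟩ := hs.lift (hA.ev JC hJC 1 one_pos) gC
  have hγ' : ∀ c, g (γ c) = gC c := fun c => LinearMap.congr_fun hγ c
  have hgf : ∀ a, g (f a) = 0 := fun a => (hs.exact _).2 ⟨a, rfl⟩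
  let Φ : (JA × JC) →ₗ[R] B := (f ∘ₗ gA).coprod γ
  have hΦ : ∀ a c, Φ (a, c) = f (gA a) + γ c := fun a c => rfl
  have sΦ : Function.Surjective Φ := by
    intro b
    obtain ⟨c, hc⟩ := sC (g b)
    obtain ⟨a, ha⟩ := (hs.exact (b - γ c)).1 (by rw [map_sub, hγ', hc, sub_self])
    obtain ⟨a', rfl⟩ := sA a
    exact ⟨(a', c), by rw [hΦ, ha]; abel⟩
  have key : ∀ x : LinearMap.ker Φ, gC x.1.2 = 0 := by
    rintro ⟨⟨a, c⟩, hx⟩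
    have := congrArg g (show Φ (a, c) = 0 from hx)
    rw [hΦ, map_add, hgf, hγ', zero_add, map_zero] at this
    exact this
  refine ⟨ModuleCat.of R (LinearMap.ker Φ), ModuleCat.of R (JA × JC), Submodule.subtype _, Φ,
    ?_, SES.ker sΦ, ModuleCat.of R (LinearMap.ker gA), ModuleCat.of R (LinearMap.ker gC),
    ((LinearMap.inl R JA JC) ∘ₗ (LinearMap.ker gA).subtype).codRestrict _ ?_,
    (LinearMap.snd R JA JC ∘ₗ (LinearMap.ker Φ).subtype).codRestrict _ key, ⟨?_, ?_, ?_⟩, kA, kC⟩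
  · refine inj_of_ev1 fun X _ _ => ?_
    have : SES (LinearMap.inl R JA JC) (LinearMap.snd R JA JC) :=
      ⟨LinearMap.inl_injective, Function.Exact.inl_snd, LinearMap.snd_surjective⟩
    exact this.cov2 (EV.of_inj one_pos) (EV.of_inj one_pos)
  · rintro ⟨a, ha⟩
    change Φ (a, 0) = 0
    rw [hΦ, show gA a = 0 from ha]; simp
  · rintro ⟨a, ha⟩ ⟨b, hb⟩ hab
    have := congrArg (fun x : LinearMap.ker Φ => x.1.1) hab
    exact Subtype.ext this
  · rintro ⟨⟨a, c⟩, hx⟩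
    constructor
    · intro h
      have hc : c = 0 := congrArg Subtype.val h
      subst hc
      have hx' : Φ (a, 0) = 0 := hx
      rw [hΦ, map_zero, add_zero] at hx'
      have : gA a = 0 := hs.inj (by rw [hx', map_zero])
      exact ⟨⟨a, this⟩, rfl⟩
    · rintro ⟨y, hy⟩
      have := congrArg (fun x : LinearMap.ker Φ => x.1.2) hy
      exact Subtype.ext this.symm
  · rintro ⟨c, hc⟩
    have hc' : gC c = 0 := hc
    obtain ⟨a, ha⟩ := (hs.exact (γ c)).1 (by rw [hγ', hc'])
    obtain ⟨a', rfl⟩ := sA a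
    refine ⟨⟨(-a', c), ?_⟩, rfl⟩
    change Φ _ = 0
    rw [hΦ, map_neg, map_neg, ha]; simp

theorem exists_int_chain {α : Type*} (S : α → α → Prop) (hr : ∀ a, ∃ b, S a b)
    (hl : ∀ a, ∃ b, S b a) (a : α) : ∃ z : ℤ → α, z 0 = a ∧ ∀ n, S (z n) (z (n + 1)) := by
  choose r hr using hr
  choose l hl using hl
  let z : ℤ → α := fun n => match n with
    | Int.ofNat n => r^[n] a
    | Int.negSucc n => l^[n + 1] a
  refine ⟨z, rfl, ?_⟩
  rintro (n | n)
  · change S (r^[n] a) (r^[n+1] a)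
    rw [Function.iterate_succ_apply']; exact hr _
  · cases n with
    | zero => exact hl a
    | succ n =>
      change S (l^[n+1+1] a) (l^[n+1] a)
      rw [Function.iterate_succ_apply']; exact hl _

theorem LGI.gi (h : LGI R A) : GG.IsGorensteinInjective R A := by
  let S : {Y : ModuleCat.{u} R // LGI R Y} → {Y : ModuleCat.{u} R // LGI R Y} → Prop :=
    fun a b => ∃ (J : ModuleCat.{u} R) (f : a.1 →ₗ[R] J) (g : J →ₗ[R] b.1),
      Module.Injective R J ∧ SES f g
  have hr : ∀ a, ∃ b, S a b := by
    rintro ⟨Y, hY⟩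
    obtain ⟨J, C, f, g, hJ, hs⟩ := exists_inj R Y
    exact ⟨⟨C, LGI.right hs hJ hY⟩, J, f, g, hJ, hs⟩
  have hl : ∀ a, ∃ b, S b a := by
    rintro ⟨Y, hY⟩
    obtain ⟨J, g, hJ, hs, hK⟩ := hY.left
    exact ⟨⟨ModuleCat.of R (LinearMap.ker g), hK⟩, J, _, g, hJ, SES.ker hs⟩
  obtain ⟨z, hz0, hz⟩ := exists_int_chain S hr hl ⟨ModuleCat.of R A, h⟩
  choose J f g hJ hs using hz
  refine ⟨J, fun n => f (n + 1) ∘ₗ g n, hJ, fun n => ?_, fun I hI n φ hφ => ?_, ?_⟩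
  · rw [LinearMap.range_comp, LinearMap.range_eq_top.2 (hs n).surj, Submodule.map_top,
      LinearMap.ker_comp, LinearMap.ker_eq_bot.2 (hs _).inj]
    exact (LinearMap.exact_iff.1 (hs (n+1)).exact).symm
  · have h1 : ∀ x, g (n+1) (φ x) = 0 := fun x =>
      (hs (n+1+1)).inj (by simpa using LinearMap.congr_fun hφ x)
    let φ' : I →ₗ[R] (z (n+1)).1 := (hs (n+1)).kerEquiv.symm.toLinearMap ∘ₗ
      φ.codRestrict (LinearMap.ker (g (n+1))) h1
    have h2 : ∀ x, f (n+1) (φ' x) = φ x := by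
      intro x
      rw [← (hs (n+1)).coe_kerEquiv]
      simp [φ']
      rfl
    obtain ⟨ψ, hψ⟩ := (hs n).lift ((z n).2.ev I hI 1 one_pos) φ'
    refine ⟨ψ, ?_⟩
    ext x
    rw [← h2]
    exact congrArg (f (n+1)) (LinearMap.congr_fun hψ x)
  · have e1 : LinearMap.ker (f (0+1) ∘ₗ g 0) = LinearMap.ker (g 0) := by
      rw [LinearMap.ker_comp, LinearMap.ker_eq_bot.2 (hs _).inj]; rfl
    have e2 : ((z 0).1 : Type u) ≃ₗ[R] LinearMap.ker (f (0+1) ∘ₗ g 0) :=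
      (hs 0).kerEquiv.trans (LinearEquiv.ofEq _ _ e1.symm)
    have e3 : (A : Type u) ≃ₗ[R] (z 0).1 := by rw [hz0]
    exact ⟨e3.trans e2⟩

theorem EVp.congr_right (e : A ≃ₗ[R] B) (h : EVp R X A) : EVp R X B :=
  fun i hi => (h i hi).congr_right e

theorem EVp.congr_left (e : A ≃ₗ[R] B) (h : EVp R A Y) : EVp R B Y :=
  fun i hi => (h i hi).congr_left e

end
end GP


namespace GP

open TensorProduct

section
variable {R : Type u} [CommRing R] {A B C X Y W : Type u} [AddCommGroup A] [Module R A]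
    [AddCommGroup B] [Module R B] [AddCommGroup C] [Module R C]
    [AddCommGroup X] [Module R X] [AddCommGroup Y] [Module R Y] [AddCommGroup W] [Module R W]
    {f : A →ₗ[R] B} {g : B →ₗ[R] C}

theorem inj_extend (hW : Module.Injective R W) (f : A →ₗ[R] B) (hf : Function.Injective f)
    (φ : A →ₗ[R] W) : ∃ ψ : B →ₗ[R] W, ψ ∘ₗ f = φ := by
  obtain ⟨ψ, hψ⟩ := hW.out f hf φ
  exact ⟨ψ, LinearMap.ext hψ⟩

/-- lifting against `Hom(-, W)` -/
theorem lift_hom (hW : Module.Injective R W) (f : A →ₗ[R] B)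
    (hf : Function.Injective (LinearMap.lTensor X f)) (φ : X →ₗ[R] (A →ₗ[R] W)) :
    ∃ ψ : X →ₗ[R] (B →ₗ[R] W), f.lcomp R W ∘ₗ ψ = φ := by
  obtain ⟨ψ, hψ⟩ := inj_extend hW _ hf (TensorProduct.lift φ)
  refine ⟨TensorProduct.curry ψ, ?_⟩
  ext x a
  simpa using LinearMap.congr_fun hψ (x ⊗ₜ a)

/-- `Hom(flat, injective)` is injective -/
theorem inj_hom (hW : Module.Injective R W) [Module.Flat R X] :
    Module.Injective R (X →ₗ[R] W) := by
  constructor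
  intro A B _ _ _ _ i hi φ
  have h1 := Module.Flat.rTensor_preserves_injective_linearMap (M := X) i hi
  obtain ⟨ψ, hψ⟩ := inj_extend hW _ h1 (TensorProduct.lift φ)
  refine ⟨TensorProduct.curry ψ, fun a => ?_⟩
  ext x
  simpa using LinearMap.congr_fun hψ (a ⊗ₜ x)

theorem SES.hom_inj (h : SES f g) (hW : Module.Injective R W) :
    SES (g.lcomp R W) (f.lcomp R W) := by
  refine ⟨fun a b hab => ?_, fun φ => ?_, fun φ => ?_⟩
  · ext c
    obtain ⟨b', rfl⟩ := h.surj c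
    exact LinearMap.congr_fun hab b'
  · constructor
    · intro hφ
      have hk : LinearMap.ker g ≤ LinearMap.ker φ := by
        intro b hb
        obtain ⟨a, rfl⟩ := (h.exact b).1 hb
        exact LinearMap.congr_fun hφ a
      refine ⟨((LinearMap.ker g).liftQ φ hk) ∘ₗ
        (g.quotKerEquivOfSurjective h.surj).symm.toLinearMap, ?_⟩
      ext b
      have : (g.quotKerEquivOfSurjective h.surj).symm (g b) = Submodule.Quotient.mk b := by
        rw [LinearEquiv.symm_apply_eq]; rfl
      simp [this]
    · rintro ⟨ψ, rfl⟩
      ext a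
      simp [h.exact.apply_apply_eq_zero]
  · exact inj_extend hW f h.inj φ

theorem gf_lgi (hW : Module.Injective R W) (h : GG.IsGorensteinFlat R A) : LGI R (A →ₗ[R] W) := by
  obtain ⟨X, d, hfl, hex, hte, ⟨e⟩⟩ := h
  -- the short exact sequences
  have hs : ∀ n, ∃ p : X n →ₗ[R] LinearMap.ker (d (n+1)), (∀ x, (p x : X (n+1)) = d n x) ∧
      SES (LinearMap.ker (d n)).subtype p := by
    intro n
    have hm : ∀ x, d n x ∈ LinearMap.ker (d (n+1)) := fun x => by
      rw [← hex]; exact ⟨x, rfl⟩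
    refine ⟨(d n).codRestrict _ hm, fun x => rfl, Subtype.val_injective, ?_, ?_⟩
    · intro x
      rw [← LinearMap.mem_ker, LinearMap.ker_codRestrict]
      simp
    · rintro ⟨y, hy⟩
      rw [← hex] at hy
      obtain ⟨x, rfl⟩ := hy
      exact ⟨x, rfl⟩
  have hti : ∀ (I : ModuleCat.{u} R), Module.Injective R I → ∀ n,
      Function.Injective (LinearMap.lTensor I (LinearMap.ker (d n)).subtype) := by
    intro I hI n
    obtain ⟨m, rfl⟩ : ∃ m : ℤ, n = m + 1 + 1 := ⟨n - 1 - 1, by ring⟩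
    rw [injective_iff_map_eq_zero]
    intro t ht
    obtain ⟨p, hp, hsp⟩ := hs (m+1)
    obtain ⟨s, rfl⟩ := LinearMap.lTensor_surjective I hsp.surj t
    rw [← LinearMap.comp_apply, ← LinearMap.lTensor_comp] at ht
    have h1 : (LinearMap.ker (d (m+1+1))).subtype ∘ₗ p = d (m+1) := LinearMap.ext hp
    rw [h1, ← LinearMap.mem_ker, ← hte I hI] at ht
    obtain ⟨r, rfl⟩ := ht
    rw [← LinearMap.comp_apply, ← LinearMap.lTensor_comp]
    have h2 : p ∘ₗ d m = 0 := by
      ext x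
      have : d (m+1) (d m x) = 0 := by
        rw [← LinearMap.mem_ker, ← hex]; exact ⟨x, rfl⟩
      simp [hp, this]
    rw [h2]; simp
  have hev : ∀ (I : ModuleCat.{u} R), Module.Injective R I → ∀ i n,
      EV R I (LinearMap.ker (d n) →ₗ[R] W) (i+1) := by
    intro I hI i
    induction i with
    | zero =>
      intro n
      obtain ⟨m, rfl⟩ : ∃ m : ℤ, n = m + 1 := ⟨n - 1, by ring⟩
      obtain ⟨p, hp, hsp⟩ := hs m
      refine (hsp.hom_inj hW).ev1_of_lift ?_ (lift_hom hW _ (hti I hI m))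
      have := inj_hom (X := X m) hW
      exact EV.of_inj one_pos
    | succ i ih =>
      intro n
      obtain ⟨m, rfl⟩ : ∃ m : ℤ, n = m + 1 := ⟨n - 1, by ring⟩
      obtain ⟨p, hp, hsp⟩ := hs m
      refine (hsp.hom_inj hW).cov1 (ih m) ?_
      have := inj_hom (X := X m) hW
      exact EV.of_inj (by omega)
  have h0 : LGI R (LinearMap.ker (d 0) →ₗ[R] W) := by
    refine ⟨fun Y => ∃ n, Nonempty ((LinearMap.ker (d n) →ₗ[R] W) ≃ₗ[R] Y), ?_, 0,
      ⟨LinearEquiv.refl _ _⟩⟩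
    rintro Y ⟨n, ⟨e⟩⟩
    refine ⟨fun I hI i hi => ?_, ?_⟩
    · obtain ⟨j, rfl⟩ := Nat.exists_eq_succ_of_ne_zero hi.ne'
      exact (hev I hI j n).congr_right e
    · obtain ⟨p, hp, hsp⟩ := hs n
      exact ⟨ModuleCat.of R (LinearMap.ker (d (n+1)) →ₗ[R] W), ModuleCat.of R (X n →ₗ[R] W),
        _, _, inj_hom (X := X n) hW, (hsp.hom_inj hW).comp_equiv e, n+1, ⟨LinearEquiv.refl _ _⟩⟩
  exact h0.congr (LinearEquiv.congrLeft W R e.symm)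

/-- Gorenstein injective dimension, recursive version. -/
def GidR (R : Type u) [CommRing R] : ℕ → ModuleCat.{u} R → Prop
  | 0, H => LGI R H
  | n + 1, H => ∃ (G H' : ModuleCat.{u} R) (f : H →ₗ[R] G) (g : G →ₗ[R] H'),
      LGI R G ∧ SES f g ∧ GidR R n H'

theorem gfd_gid (hW : Module.Injective R W) (n : ℕ) (M : Type u) [AddCommGroup M] [Module R M]
    (h : GG.gfdLE R M n) : GidR R n (ModuleCat.of R (M →ₗ[R] W)) := by
  induction n generalizing M with
  | zero =>
    obtain ⟨G, d, ε, hG, hε, hk, he, hz⟩ := h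
    have hinj : Function.Injective ε := by
      rw [← LinearMap.ker_eq_bot, hk, LinearMap.range_eq_bot]
      ext x
      rw [hz 1 one_pos x, map_zero, map_zero]
    exact (gf_lgi hW (hG 0)).congr
      (LinearEquiv.congrLeft W R (LinearEquiv.ofBijective ε ⟨hinj, hε⟩))
  | succ n ih =>
    obtain ⟨G, d, ε, hG, hε, hk, he, hz⟩ := h
    refine ⟨ModuleCat.of R (G 0 →ₗ[R] W), ModuleCat.of R (LinearMap.ker ε →ₗ[R] W), _, _,
      gf_lgi hW (hG 0), (SES.ker hε).hom_inj hW, ih (LinearMap.ker ε) ?_⟩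
    refine ⟨fun i => G (i+1), fun i => d (i+1),
      (d 0).codRestrict _ fun x => by rw [hk]; exact ⟨x, rfl⟩, fun i => hG _, ?_, ?_, fun i => he _,
      fun i hi => hz _ (by omega)⟩
    · rintro ⟨y, hy⟩
      rw [hk] at hy
      obtain ⟨x, rfl⟩ := hy
      exact ⟨x, rfl⟩
    · rw [LinearMap.ker_codRestrict, he]

theorem FID.of_inj [Module.Injective R Y] : FID R 0 Y := fun _ _ hi => EV.of_inj hi

theorem FID.left {n : ℕ} (hs : SES f g) (hB : Module.Injective R B) (hC : FID R n C) :
    FID R (n+1) A := by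
  intro X i hi
  obtain ⟨j, rfl⟩ := Nat.exists_eq_succ_of_ne_zero (by omega : i ≠ 0)
  exact hs.cov1 (hC X j (by omega)) (EV.of_inj (by omega))

theorem FID.right {n : ℕ} (hs : SES f g) (hB : Module.Injective R B) (hA : FID R (n+1) A) :
    FID R n C := by
  intro X i hi
  exact hs.cov3 (EV.of_inj (by omega)) (hA X _ (by omega))

theorem gid_approx (n : ℕ) (H : ModuleCat.{u} R) (h : GidR R n H) :
    ∃ (K Q : ModuleCat.{u} R) (f : K →ₗ[R] Q) (g : Q →ₗ[R] H) (m : ℕ), SES f g ∧ LGI R K ∧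
      FID R m Q := by
  induction n generalizing H with
  | zero =>
    obtain ⟨J, g, hJ, hs, hK⟩ := LGI.left h
    exact ⟨ModuleCat.of R (LinearMap.ker g), J, _, g, 0, SES.ker hs, hK, FID.of_inj⟩
  | succ n ih =>
    obtain ⟨G, H', f, g, hG, hs, hH'⟩ := h
    obtain ⟨K', Q', f', g', m, hs', hK', hQ'⟩ := ih H' hH'
    let P : Submodule R (G × Q') := LinearMap.ker ((g ∘ₗ LinearMap.fst R G Q') -
      (g' ∘ₗ LinearMap.snd R G Q'))
    have hPm : ∀ x : G × Q', x ∈ P ↔ g x.1 = g' x.2 := by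
      intro x
      rw [LinearMap.mem_ker, LinearMap.sub_apply, sub_eq_zero]; rfl
    have hPs : SES ((LinearMap.inr R G Q' ∘ₗ f').codRestrict P fun k => by
        rw [hPm]; simp [hs'.exact.apply_apply_eq_zero])
        (LinearMap.fst R G Q' ∘ₗ P.subtype) := by
      refine ⟨fun a b hab => ?_, ?_, ?_⟩
      · have := congrArg (fun x : P => x.1.2) hab
        exact hs'.inj this
      · rintro ⟨⟨a, b⟩, hx⟩
        have hx' := (hPm _).1 hx
        constructor
        · intro h0
          have h0' : a = 0 := h0
          subst h0'
          simp only [map_zero] at hx'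
          obtain ⟨k, hk⟩ := (hs'.exact b).1 hx'.symm
          exact ⟨k, Subtype.ext (Prod.ext rfl hk)⟩
        · rintro ⟨k, hk⟩
          exact (congrArg (fun x : P => x.1.1) hk).symm
      · intro a
        obtain ⟨b, hb⟩ := hs'.surj (g a)
        exact ⟨⟨(a, b), (hPm _).2 hb.symm⟩, rfl⟩
    have hPL : LGI R P := LGI.extension hPs hK' hG
    obtain ⟨J, π, hJ, hπ, hK⟩ := hPL.left
    let ρ : J →ₗ[R] Q' := LinearMap.snd R G Q' ∘ₗ P.subtype ∘ₗ π
    have hρ : Function.Surjective ρ := by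
      intro b
      obtain ⟨a, ha⟩ := hs.surj (g' b)
      obtain ⟨j, hj⟩ := hπ ⟨(a, b), (hPm _).2 ha⟩
      refine ⟨j, ?_⟩
      change (π j).1.2 = b
      rw [hj]
    let τ : LinearMap.ker ρ →ₗ[R] LinearMap.ker g :=
      (LinearMap.fst R G Q' ∘ₗ P.subtype ∘ₗ π ∘ₗ (LinearMap.ker ρ).subtype).codRestrict _ (by
        rintro ⟨j, hj⟩
        have hj' : (π j).1.2 = 0 := hj
        have := (hPm _).1 (π j).2
        rw [hj', map_zero] at this
        exact this)
    have hτ : SES (Submodule.inclusion (show LinearMap.ker π ≤ LinearMap.ker ρ from fun x hx => by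
        change (π x).1.2 = 0
        rw [show π x = 0 from hx]; rfl)) τ := by
      refine ⟨Submodule.inclusion_injective _, ?_, ?_⟩
      · rintro ⟨j, hj⟩
        constructor
        · intro h0
          have h0' : (π j).1.1 = 0 := congrArg Subtype.val h0
          have hj' : (π j).1.2 = 0 := hj
          have : π j = 0 := Subtype.ext (Prod.ext h0' hj')
          exact ⟨⟨j, this⟩, rfl⟩
        · rintro ⟨⟨k, hk⟩, hkj⟩
          have : k = j := congrArg Subtype.val hkj
          subst this
          apply Subtype.ext
          change (π k).1.1 = 0
          rw [show π k = 0 from hk]; rfl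
      · rintro ⟨a, ha⟩
        obtain ⟨j, hj⟩ := hπ ⟨(a, 0), (hPm _).2 (by simpa using ha)⟩
        refine ⟨⟨j, ?_⟩, ?_⟩
        · change (π j).1.2 = 0
          rw [hj]
        · apply Subtype.ext
          change (π j).1.1 = a
          rw [hj]
    exact ⟨ModuleCat.of R (LinearMap.ker π), ModuleCat.of R (LinearMap.ker ρ), _, _, m + 1,
      hτ.comp_equiv hs.kerEquiv.symm, hK, FID.left (SES.ker hρ) hJ hQ'⟩

theorem FID.inj (n : ℕ) (Q : ModuleCat.{u} R) (h : FID R n Q)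
    (hI : ∀ I : ModuleCat.{u} R, Module.Injective R I → EVp R I Q) : Module.Injective R Q := by
  induction n generalizing Q with
  | zero => exact inj_of_ev1 fun X _ _ => h (ModuleCat.of R X) 1 one_pos
  | succ n ih =>
    obtain ⟨J, C, f, g, hJ, hs⟩ := exists_inj R Q
    have hC : Module.Injective R C := by
      refine ih C (h.right hs hJ) fun I hII i hi => ?_
      exact hs.cov3 (EV.of_inj (by omega)) (hI I hII _ (by omega))
    obtain ⟨s, hsg⟩ := hs.lift (hI C hC 1 one_pos) LinearMap.id
    refine inj_of_ev1 fun X _ _ => ?_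
    refine hs.ev1_of_lift (EV.of_inj one_pos) fun φ => ⟨s ∘ₗ φ, ?_⟩
    rw [← LinearMap.comp_assoc, hsg, LinearMap.id_comp]

theorem gid_crit (n : ℕ) (H : ModuleCat.{u} R) (h : GidR R n H)
    (hI : ∀ I : ModuleCat.{u} R, Module.Injective R I → EVp R I H) : LGI R H := by
  obtain ⟨K, Q, f, g, m, hs, hK, hQ⟩ := gid_approx n H h
  have : Module.Injective R Q := hQ.inj m Q fun I hII i hi =>
    hs.cov2 (hK.ev I hII i hi) (hI I hII i hi)
  exact LGI.right hs this hK

theorem LGI.ev_fpd {n : ℕ} (hX : FPD R n X) (hA : LGI R A) : EVp R X A := by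
  have : ∀ m : ℕ, ∀ K : ModuleCat.{u} R, LGI R K → ∀ i, 0 < i → n < i + m → EV R X K i := by
    intro m
    induction m with
    | zero => intro K _ i _ h; exact hX K i h
    | succ m ih =>
      intro K hK i hi h
      obtain ⟨J, g, hJ, hs, hK'⟩ := hK.left
      exact (SES.ker hs).cov3 (EV.of_inj hi) (ih (ModuleCat.of R (LinearMap.ker g)) hK' (i+1)
        (by omega) (by omega))
  intro i hi
  exact this n (ModuleCat.of R A) hA i hi (by omega)

theorem LGI.ev_fid (n : ℕ) (L : ModuleCat.{u} R) (hL : FID R n L) (hA : LGI R A) :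
    EVp R L A := by
  induction n generalizing L with
  | zero =>
    exact hA.ev L (inj_of_ev1 fun X _ _ => hL (ModuleCat.of R X) 1 one_pos)
  | succ n ih =>
    obtain ⟨J, C, f, g, hJ, hs⟩ := exists_inj R L
    intro i hi
    exact hs.con1 (hA.ev J hJ i hi) (ih C (hL.right hs hJ) _ (by omega))

end
end GP


namespace GP

open TensorProduct

section
variable {R : Type u} [CommRing R] {A B C X Y W M : Type u} [AddCommGroup A] [Module R A]
    [AddCommGroup B] [Module R B] [AddCommGroup C] [Module R C]
    [AddCommGroup X] [Module R X] [AddCommGroup Y] [Module R Y] [AddCommGroup W] [Module R W]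
    [AddCommGroup M] [Module R M]
    {f : A →ₗ[R] B} {g : B →ₗ[R] C}

theorem SES.fpd {n : ℕ} (hs : SES f g) (hA : FPD R n A) (hB : FPD R n B) : FPD R (n+1) C := by
  intro X i hi
  obtain ⟨j, rfl⟩ := Nat.exists_eq_succ_of_ne_zero (by omega : i ≠ 0)
  exact hs.con3 (hA X j (by omega)) (hB X _ (by omega))

theorem SES.fid {n : ℕ} (hs : SES f g) (hB : FID R n B) (hC : FID R n C) : FID R (n+1) A := by
  intro X i hi
  obtain ⟨j, rfl⟩ := Nat.exists_eq_succ_of_ne_zero (by omega : i ≠ 0)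
  exact hs.cov1 (hC X j (by omega)) (hB X _ (by omega))

theorem evp_quot (hW : Module.Injective R W) {x : R} (h1 : IsSMulRegular B x)
    (h2 : IsSMulRegular (B ⊗[R] M) x) (h : EVp R B (M →ₗ[R] W)) :
    EVp R (QuotSMulTop x B) (M →ₗ[R] W) := by
  have hs := SES.smul_of_reg h1
  intro i hi
  obtain ⟨j, rfl⟩ := Nat.exists_eq_succ_of_ne_zero hi.ne'
  rcases Nat.eq_zero_or_pos j with rfl | hj
  · refine hs.ev1_of_ext (h 1 one_pos) fun φ => ?_
    have hi : Function.Injective (x • (LinearMap.id : B ⊗[R] M →ₗ[R] B ⊗[R] M)) :=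
      fun a b hab => h2 (by simpa using hab)
    obtain ⟨ψ, hψ⟩ := inj_extend hW _ hi (TensorProduct.lift φ)
    refine ⟨TensorProduct.curry ψ, ?_⟩
    ext b m
    simpa using LinearMap.congr_fun hψ (b ⊗ₜ m)
  · exact hs.con3 (h j hj) (h _ (by omega))

theorem red [IsLocalRing R] [IsNoetherianRing R] [Module.Finite R M]
    (hW : Module.Injective R W) (rs : List R) :
    ∀ B : ModuleCat.{u} R, Module.Finite R B → RingTheory.Sequence.IsWeaklyRegular B rs →
    RingTheory.Sequence.IsWeaklyRegular (B ⊗[R] M) rs →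
    (∀ r ∈ rs, r ∈ IsLocalRing.maximalIdeal R) → (∃ n, FPD R n B) →
    (∃ n, FID R n (B →ₗ[R] W)) → EVp R B (M →ₗ[R] W) →
    ∃ S : ModuleCat.{u} R, Module.Finite R S ∧
      Module.supportDim R S + rs.length = Module.supportDim R B ∧ (∃ n, FPD R n S) ∧
      (∃ n, FID R n (S →ₗ[R] W)) ∧ EVp R S (M →ₗ[R] W) ∧ ∀ i, EV R M S i → EV R M B i := by
  induction rs with
  | nil =>
    intro B hf _ _ _ h1 h2 h3
    exact ⟨B, hf, by simp, h1, h2, h3, fun _ h => h⟩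
  | cons r rs ih =>
    intro B hf hr hr' hm ⟨n, h1⟩ ⟨k, h2⟩ h3
    rw [RingTheory.Sequence.isWeaklyRegular_cons_iff] at hr hr'
    have hs := SES.smul_of_reg hr.1
    have hrm : r ∈ IsLocalRing.maximalIdeal R := hm r (by simp)
    obtain ⟨S, hS, h4, h5, h6, h7, h8⟩ := ih (ModuleCat.of R (QuotSMulTop r B))
      (inferInstanceAs (Module.Finite R (QuotSMulTop r B))) hr.2
      (((QuotSMulTop.quotSMulTopTensorEquivQuotSMulTop r M B).isWeaklyRegular_congr rs).2 hr'.2)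
      (fun r hr => hm r (by simp [hr])) ⟨_, hs.fpd h1 h1⟩ ⟨_, (hs.hom_inj hW).fid h2 h2⟩
      (evp_quot hW hr.1 hr'.1 h3)
    refine ⟨S, hS, ?_, h5, h6, h7, fun i hi => hs.nak_right hrm (h8 i hi)⟩
    rw [← Module.supportDim_quotSMulTop_succ_eq_supportDim hr.1 hrm]
    rw [List.length_cons, Nat.cast_add, Nat.cast_one, ← add_assoc]
    exact congrArg (· + 1) h4

/-- Vanishing from depth and injective dimension. -/
theorem ev_depth [IsLocalRing R] [IsNoetherianRing R] [Module.Finite R Y] {n : ℕ}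
    (hY : FID R n Y) (rs : List R) : ∀ B : ModuleCat.{u} R, Module.Finite R B →
    RingTheory.Sequence.IsWeaklyRegular B rs → (∀ r ∈ rs, r ∈ IsLocalRing.maximalIdeal R) →
    ∀ i, n < i + rs.length → EV R B Y i := by
  induction rs with
  | nil => intro B _ _ _ i hi; exact hY B i hi
  | cons r rs ih =>
    intro B hf hr hm i hi
    rw [RingTheory.Sequence.isWeaklyRegular_cons_iff] at hr
    have hs := SES.smul_of_reg hr.1
    exact hs.nak_left (hm r (by simp)) (ih (ModuleCat.of R (QuotSMulTop r B))
      (inferInstanceAs (Module.Finite R (QuotSMulTop r B))) hr.2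
      (fun r hr => hm r (by simp [hr])) (i+1) (by simp at hi; omega))

theorem wr_retract (rs : List R) : ∀ (A B : ModuleCat.{u} R) (i : A →ₗ[R] B) (p : B →ₗ[R] A),
    p ∘ₗ i = LinearMap.id → RingTheory.Sequence.IsWeaklyRegular B rs →
    RingTheory.Sequence.IsWeaklyRegular A rs := by
  induction rs with
  | nil => intro A B i p _ _; exact RingTheory.Sequence.IsWeaklyRegular.nil _ _
  | cons r rs ih =>
    intro A B i p h hr
    rw [RingTheory.Sequence.isWeaklyRegular_cons_iff] at hr ⊢
    have hpi : ∀ a, p (i a) = a := fun a => LinearMap.congr_fun h a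
    refine ⟨fun a b hab => ?_, ih (ModuleCat.of R (QuotSMulTop r A))
      (ModuleCat.of R (QuotSMulTop r B)) (QuotSMulTop.map r i) (QuotSMulTop.map r p) ?_ hr.2⟩
    · have : i a = i b := hr.1 (by
        change r • i a = r • i b
        rw [← map_smul, ← map_smul]
        exact congrArg i hab)
      rw [← hpi a, this, hpi]
    · rw [← QuotSMulTop.map_comp, h]
      exact QuotSMulTop.map_id _ _

theorem depth_seq [IsLocalRing R] [Nontrivial A] {d : ℕ}
    (h : (GG.mdepth R A : WithBot ℕ∞) = (d : WithBot ℕ∞)) :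
    ∃ rs : List R, rs.length = d ∧ (∀ r ∈ rs, r ∈ IsLocalRing.maximalIdeal R) ∧
      RingTheory.Sequence.IsRegular A rs := by
  have h' : GG.mdepth R A = (d : ℕ∞) := by exact_mod_cast h
  have hne : {c : ℕ∞ | ∃ rs : List R, c = rs.length ∧
    (∀ r ∈ rs, r ∈ IsLocalRing.maximalIdeal R) ∧ RingTheory.Sequence.IsRegular A rs}.Nonempty :=
    ⟨0, [], by simp, by simp, RingTheory.Sequence.IsRegular.nil _ _⟩
  have := @ENat.sSup_mem_of_nonempty_of_lt_top _ hne.to_subtype (by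
    change GG.mdepth R A < ⊤
    rw [h']; exact ENat.natCast_lt_top d)
  obtain ⟨rs, h1, h2, h3⟩ := this
  refine ⟨rs, ?_, h2, h3⟩
  have h4 : GG.mdepth R A = rs.length := h1
  rw [h'] at h4
  exact_mod_cast h4.symm

theorem common_seq [IsLocalRing R] [IsNoetherianRing R] [Module.Finite R M]
    (hR : GG.IsCMLocalRing R) (hM : GG.IsMaximalCM R M) :
    ∃ rs : List R, (rs.length : WithBot ℕ∞) = ringKrullDim R ∧
      (∀ r ∈ rs, r ∈ IsLocalRing.maximalIdeal R) ∧
      RingTheory.Sequence.IsWeaklyRegular R rs ∧ RingTheory.Sequence.IsWeaklyRegular M rs := by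
  have hfin : FiniteRingKrullDim R := inferInstance
  obtain ⟨d, hd⟩ : ∃ d : ℕ, ringKrullDim R = (d : WithBot ℕ∞) :=
    ((Order.finiteDimensionalOrder_iff_krullDim_ne_bot_and_top.1 hfin) |> fun h => by
      have h1 : ringKrullDim R ≠ ⊥ := h.1
      have h2 : ringKrullDim R ≠ ⊤ := h.2
      generalize ringKrullDim R = x at h1 h2
      induction x with
      | bot => exact absurd rfl h1
      | coe x =>
        induction x with
        | top => exact absurd rfl h2
        | coe n => exact ⟨n, rfl⟩)
  have hMn : Nontrivial M := by
    by_contra hn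
    rw [not_nontrivial_iff_subsingleton] at hn
    have h2 := hM.2
    have h3 : GG.mdim R M = ⊥ := Module.supportDim_eq_bot_of_subsingleton R M
    rw [h3, hd] at h2
    simp at h2
  obtain ⟨rs1, h11, h12, h13⟩ := depth_seq (A := R) (d := d) (hR.trans hd)
  obtain ⟨rs2, h21, h22, h23⟩ := depth_seq (A := M) (d := d) (hM.1.trans (hM.2.trans hd))
  have hsm : ∀ (X : Type u) [AddCommGroup X] [Module R X] [Module.Finite R X] [Nontrivial X],
      IsLocalRing.maximalIdeal R • (⊤ : Submodule R X) < ⊤ := by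
    intro X _ _ _ _
    refine lt_top_iff_ne_top.2 fun h => ?_
    have := Submodule.eq_bot_of_le_smul_of_le_jacobson_bot (IsLocalRing.maximalIdeal R)
      (⊤ : Submodule R X) Module.Finite.fg_top h.ge (IsLocalRing.maximalIdeal_le_jacobson _)
    exact top_ne_bot this
  have hsupp : Module.support R (R ⧸ IsLocalRing.maximalIdeal R) =
      PrimeSpectrum.zeroLocus (IsLocalRing.maximalIdeal R) := by
    rw [Module.support_eq_zeroLocus, Ideal.annihilator_quotient]
  have e1 := ModuleCat.subsingleton_ext_of_exists_isRegular (IsLocalRing.maximalIdeal R)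
    (ModuleCat.of R (R ⧸ IsLocalRing.maximalIdeal R)) hsupp.le (ModuleCat.of R R) (hsm R)
    rs1 h12 h13
  have e2 := ModuleCat.subsingleton_ext_of_exists_isRegular (IsLocalRing.maximalIdeal R)
    (ModuleCat.of R (R ⧸ IsLocalRing.maximalIdeal R)) hsupp.le (ModuleCat.of R M) (hsm M)
    rs2 h22 h23
  have hs : SES (LinearMap.inl R R M) (LinearMap.snd R R M) :=
    ⟨LinearMap.inl_injective, Function.Exact.inl_snd, Prod.snd_surjective⟩
  obtain ⟨rs, h1, h2, h3⟩ := ModuleCat.exists_isRegular_of_exists_subsingleton_ext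
    (IsLocalRing.maximalIdeal R) d (ModuleCat.of R (R × M)) (hsm (R × M))
    (ModuleCat.of R (R ⧸ IsLocalRing.maximalIdeal R)) hsupp
    (fun i hi => hs.cov2 (e1 i (h11 ▸ hi)) (e2 i (h21 ▸ hi)))
  refine ⟨rs, by rw [h1, hd], h2, ?_, ?_⟩
  · exact wr_retract rs (ModuleCat.of R R) (ModuleCat.of R (R × M)) (LinearMap.inl R R M)
      (LinearMap.fst R R M) (LinearMap.fst_comp_inl _ _ _) h3.toIsWeaklyRegular
  · exact wr_retract rs (ModuleCat.of R M) (ModuleCat.of R (R × M)) (LinearMap.inr R R M)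
      (LinearMap.snd R R M) (LinearMap.snd_comp_inr _ _ _) h3.toIsWeaklyRegular

/-- a nonzero finite module with zero dimensional support -/
theorem dim_zero [IsLocalRing R] [IsNoetherianRing R] [Module.Finite R A]
    (h : Module.supportDim R A = 0) :
    (∃ t : ℕ, ∀ r ∈ IsLocalRing.maximalIdeal R ^ t, ∀ a : A, r • a = 0) ∧
    ∃ j : (R ⧸ IsLocalRing.maximalIdeal R) →ₗ[R] A, Function.Injective j := by
  have hn : Nontrivial A := by
    by_contra hn
    rw [not_nontrivial_iff_subsingleton] at hn
    rw [Module.supportDim_eq_bot_of_subsingleton] at h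
    simp at h
  obtain ⟨p0, hp0⟩ := (Module.nonempty_support_iff (R := R)).2 hn
  have hall : ∀ p ∈ Module.support R A, p = IsLocalRing.closedPoint R := by
    intro p hp
    by_contra hpm
    have hle : p ≤ IsLocalRing.closedPoint R := IsLocalRing.le_maximalIdeal p.2.ne_top
    have hc : IsLocalRing.closedPoint R ∈ Module.support R A :=
      Module.mem_support_mono hle hp
    have hlt : (⟨p, hp⟩ : Module.support R A) < ⟨IsLocalRing.closedPoint R, hc⟩ :=
      lt_of_le_of_ne hle (fun h => hpm (congrArg Subtype.val h))
    have := Order.krullDim_pos_iff.2 ⟨_, _, hlt⟩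
    exact absurd h this.ne'
  have hrad : IsLocalRing.maximalIdeal R ≤ (Module.annihilator R A).radical := by
    rw [Ideal.radical_eq_sInf]
    refine le_sInf fun J hJ => ?_
    have : (⟨J, hJ.2⟩ : PrimeSpectrum R) ∈ Module.support R A := by
      rw [Module.support_eq_zeroLocus]; exact hJ.1
    have := hall _ this
    exact (congrArg PrimeSpectrum.asIdeal this).ge
  obtain ⟨t, ht⟩ := Ideal.exists_pow_le_of_le_radical_of_fg hrad (IsNoetherian.noetherian _)
  refine ⟨⟨t, fun r hr a => ?_⟩, ?_⟩
  · exact Module.mem_annihilator.1 (ht hr) a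
  · obtain ⟨p, hp⟩ := associatedPrimes.nonempty R A
    have hp' : IsAssociatedPrime p A := hp
    obtain ⟨hpr, j, hj⟩ := (isAssociatedPrime_iff_exists_injective_linearMap p A).1 hp'
    have h1 : Module.annihilator R A ≤ p := by
      intro r hr
      have := hj (a₁ := Ideal.Quotient.mk p r) (a₂ := 0) (by
        rw [map_zero, ← mul_one r, map_mul]
        change j (r • (1 : R ⧸ p)) = 0
        rw [map_smul]
        exact Module.mem_annihilator.1 hr _)
      exact Ideal.Quotient.eq_zero_iff_mem.1 this
    have h2 : IsLocalRing.maximalIdeal R = p :=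
      le_antisymm (hrad.trans (hpr.radical_le_iff.2 h1)) (IsLocalRing.le_maximalIdeal hpr.ne_top)
    rw [h2]
    exact ⟨j, hj⟩

end
end GP


namespace GP

open TensorProduct

section
variable {R : Type u} [CommRing R] {A B C X Y W M S : Type u} [AddCommGroup A] [Module R A]
    [AddCommGroup B] [Module R B] [AddCommGroup C] [Module R C]
    [AddCommGroup X] [Module R X] [AddCommGroup Y] [Module R Y] [AddCommGroup W] [Module R W]
    [AddCommGroup M] [Module R M] [AddCommGroup S] [Module R S]
    {f : A →ₗ[R] B} {g : B →ₗ[R] C}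

theorem ev_finsupp {κ : Type u} (n : ℕ) : ∀ Q : ModuleCat.{u} R, EV R S Q (n+1) →
    EV R (κ →₀ S) Q (n+1) := by
  induction n with
  | zero =>
    intro Q h
    obtain ⟨J, C, f, g, hJ, hs⟩ := exists_inj R Q
    refine hs.ev1_of_lift (EV.of_inj one_pos) fun φ => ?_
    have := fun k : κ => hs.lift h (φ ∘ₗ Finsupp.lsingle k)
    choose ψ hψ using this
    refine ⟨Finsupp.lsum R ψ, ?_⟩
    ext k s
    simpa using LinearMap.congr_fun (hψ k) s
  | succ n ih =>
    intro Q h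
    obtain ⟨J, C, f, g, hJ, hs⟩ := exists_inj R Q
    exact hs.cov1 (ih C (hs.cov3 (EV.of_inj (by omega)) h)) (EV.of_inj (by omega))

theorem ev_killed [IsLocalRing R] {i : ℕ} (hi : 0 < i)
    (h : EV R (R ⧸ IsLocalRing.maximalIdeal R) Y i)
    (hX : ∀ r ∈ IsLocalRing.maximalIdeal R, ∀ a : X, r • a = 0) : EV R X Y i := by
  have ht : Module.IsTorsionBySet R X (IsLocalRing.maximalIdeal R : Set R) :=
    fun a r => hX r r.2 a
  let _ : Module (R ⧸ IsLocalRing.maximalIdeal R) X := ht.module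
  let _ : Field (R ⧸ IsLocalRing.maximalIdeal R) := Ideal.Quotient.field _
  have : IsScalarTower R (R ⧸ IsLocalRing.maximalIdeal R) X :=
    Module.IsTorsionBySet.isScalarTower ht
  let b := Module.Basis.ofVectorSpace (R ⧸ IsLocalRing.maximalIdeal R) X
  let e := b.repr.restrictScalars R
  obtain ⟨j, rfl⟩ := Nat.exists_eq_succ_of_ne_zero hi.ne'
  exact (ev_finsupp j (ModuleCat.of R Y) h).congr_left e.symm

theorem ev_pow [IsLocalRing R] {i : ℕ} (hi : 0 < i)
    (h : EV R (R ⧸ IsLocalRing.maximalIdeal R) Y i) (t : ℕ) : ∀ X : ModuleCat.{u} R,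
    (∀ r ∈ IsLocalRing.maximalIdeal R ^ t, ∀ a : X, r • a = 0) → EV R X Y i := by
  induction t with
  | zero =>
    intro X hX
    have : Subsingleton X := ⟨fun a b => by
      rw [← one_smul R a, ← one_smul R b, hX 1 (by simp), hX 1 (by simp)]⟩
    exact EV.of_sub_left
  | succ t ih =>
    intro X hX
    let N : Submodule R X := IsLocalRing.maximalIdeal R • ⊤
    have hs : SES N.subtype N.mkQ :=
      ⟨N.subtype_injective, LinearMap.exact_subtype_mkQ N, N.mkQ_surjective⟩
    refine hs.con2 (ih (ModuleCat.of R N) ?_) (ev_killed hi h ?_)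
    · rintro r hr ⟨a, ha⟩
      ext
      change r • a = 0
      refine Submodule.smul_induction_on ha ?_ ?_
      · intro s hs' x _
        rw [smul_smul]
        refine hX _ ?_ x
        rw [pow_succ]
        exact Ideal.mul_mem_mul hr hs'
      · intro x y hx hy
        rw [smul_add, hx, hy, add_zero]
    · intro r hr a
      obtain ⟨a, rfl⟩ := N.mkQ_surjective a
      rw [← map_smul, Submodule.mkQ_apply, Submodule.Quotient.mk_eq_zero]
      exact Submodule.smul_mem_smul hr trivial

theorem ev_art [IsLocalRing R] {n : ℕ} (hY : FID R n Y) (hS : EVp R S Y)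
    (j : (R ⧸ IsLocalRing.maximalIdeal R) →ₗ[R] S) (hj : Function.Injective j) {t : ℕ}
    (ht : ∀ r ∈ IsLocalRing.maximalIdeal R ^ t, ∀ a : S, r • a = 0) (m : ℕ) :
    ∀ i, 0 < i → n < i + m → EV R (R ⧸ IsLocalRing.maximalIdeal R) Y i := by
  induction m with
  | zero => intro i _ hi; exact hY (ModuleCat.of R _) i hi
  | succ m ih =>
    intro i hi hn
    have hs : SES j (LinearMap.range j).mkQ :=
      ⟨hj, LinearMap.exact_map_mkQ_range j, Submodule.mkQ_surjective _⟩
    refine hs.con1 (hS i hi) (ev_pow (by omega) (ih (i+1) (by omega) (by omega)) t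
      (ModuleCat.of R _) ?_)
    intro r hr a
    obtain ⟨a, rfl⟩ := Submodule.mkQ_surjective _ a
    rw [← map_smul, ht r hr, map_zero]

/-- A6 -/
theorem a6 [IsLocalRing R] (hW : Module.Injective R W) {n : ℕ} (hM : GG.gfdLE R M n)
    {n1 n2 : ℕ} (h1 : FPD R n1 S) (h2 : FID R n2 (S →ₗ[R] W)) (h3 : EVp R S (M →ₗ[R] W))
    (j : (R ⧸ IsLocalRing.maximalIdeal R) →ₗ[R] S) (hj : Function.Injective j) {t : ℕ}
    (ht : ∀ r ∈ IsLocalRing.maximalIdeal R ^ t, ∀ a : S, r • a = 0) :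
    EVp R (S →ₗ[R] W) (M →ₗ[R] W) := by
  obtain ⟨K, Q, f, g, m, hs, hK, hQ⟩ := gid_approx n _ (gfd_gid hW n M hM)
  have hSQ : EVp R S Q := fun i hi => hs.cov2 (hK.ev_fpd h1 i hi) (h3 i hi)
  intro i hi
  refine hs.cov3 (ev_pow hi (ev_art hQ hSQ j hj ht m i hi (by omega)) t (ModuleCat.of R _) ?_)
    (LGI.ev_fid n2 (ModuleCat.of R (S →ₗ[R] W)) h2 hK _ (by omega))
  intro r hr φ
  ext s
  change r • φ s = 0
  rw [← map_smul, ht r hr, map_zero]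

end
end GP


namespace GP

open TensorProduct

section
variable {R : Type u} [CommRing R] {A B C X Y W M S : Type u} [AddCommGroup A] [Module R A]
    [AddCommGroup B] [Module R B] [AddCommGroup C] [Module R C]
    [AddCommGroup X] [Module R X] [AddCommGroup Y] [Module R Y] [AddCommGroup W] [Module R W]
    [AddCommGroup M] [Module R M] [AddCommGroup S] [Module R S]

/-- the evaluation map -/
noncomputable def th (R : Type u) [CommRing R] (B W Y : Type u) [AddCommGroup B] [Module R B]
    [AddCommGroup W] [Module R W] [AddCommGroup Y] [Module R Y] :
    (B →ₗ[R] W) ⊗[R] Y →ₗ[R] ((Y →ₗ[R] B) →ₗ[R] W) :=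
  TensorProduct.lift (LinearMap.mk₂ R
    (fun (φ : B →ₗ[R] W) (y : Y) => φ ∘ₗ (LinearMap.applyₗ y : (Y →ₗ[R] B) →ₗ[R] B))
    (fun _ _ _ => by ext; simp) (fun _ _ _ => by ext; simp) (fun _ _ _ => by ext; simp)
    (fun _ _ _ => by ext; simp))

@[simp] theorem th_tmul (φ : B →ₗ[R] W) (y : Y) (α : Y →ₗ[R] B) : th R B W Y (φ ⊗ₜ y) α = φ (α y) :=
  rfl

theorem th_nat (p : X →ₗ[R] Y) (z : (B →ₗ[R] W) ⊗[R] X) :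
    th R B W Y (p.lTensor _ z) = th R B W X z ∘ₗ p.lcomp R B := by
  induction z with
  | zero => ext; simp
  | add a b ha hb => rw [map_add, map_add, ha, hb, map_add]; rfl
  | tmul φ x => ext α; simp

theorem th_free (n : ℕ) : Function.Bijective (th R B W (Fin n → R)) := by
  let al : Fin n → B →ₗ[R] ((Fin n → R) →ₗ[R] B) := fun i =>
    LinearMap.mk₂ R (fun b x => x i • b) (fun _ _ _ => by simp) (fun c b x => smul_comm (x i) c b)
      (fun _ _ _ => by simp [add_smul]) (fun _ _ _ => by simp [mul_smul])
  let rho : (((Fin n → R) →ₗ[R] B) →ₗ[R] W) →ₗ[R] (B →ₗ[R] W) ⊗[R] (Fin n → R) :=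
    ∑ i, (TensorProduct.mk R _ _).flip (Pi.single i 1) ∘ₗ (al i).lcomp R W
  refine Function.bijective_iff_has_inverse.2 ⟨rho, fun z => ?_, fun ξ => ?_⟩
  · induction z with
    | zero => simp
    | add a b ha hb => rw [map_add, map_add, ha, hb]
    | tmul φ y =>
      have h1 : ∀ i, (th R B W (Fin n → R) (φ ⊗ₜ y)) ∘ₗ al i = y i • φ := by
        intro i; ext b; simp [al]
      have h2 : y = ∑ i, y i • (Pi.single i (1 : R) : Fin n → R) := by
        ext j; simp [Finset.sum_apply, Pi.single_apply]
      conv_rhs => rw [h2, TensorProduct.tmul_sum]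
      have h3 : ∀ i, (al i).lcomp R W (th R B W (Fin n → R) (φ ⊗ₜ y)) = y i • φ := h1
      simp [rho, LinearMap.sum_apply, h3]
  · ext α
    have h2 : α = ∑ i, al i (α (Pi.single i 1)) := by
      ext j; simp [al, LinearMap.sum_apply, Pi.single_apply]
    conv_rhs => rw [h2, map_sum]
    simp [rho, LinearMap.sum_apply]

theorem th_surj (hW : Module.Injective R W) {n : ℕ} (p : (Fin n → R) →ₗ[R] Y)
    (hp : Function.Surjective p) : Function.Surjective (th R B W Y) := by
  intro ξ
  have hi : Function.Injective (p.lcomp R B) := by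
    intro a b hab
    ext y
    obtain ⟨x, rfl⟩ := hp y
    exact LinearMap.congr_fun hab x
  obtain ⟨ξ', rfl⟩ := inj_extend hW _ hi ξ
  obtain ⟨z, rfl⟩ := (th_free n).2 ξ'
  exact ⟨_, th_nat p z⟩

theorem th_inj (hW : Module.Injective R W) {n : ℕ} {Z : Type u} [AddCommGroup Z] [Module R Z]
    {i : Z →ₗ[R] (Fin n → R)} {p : (Fin n → R) →ₗ[R] Y} (hs : SES i p)
    (hZ : Function.Surjective (th R B W Z)) : Function.Injective (th R B W Y) := by
  rw [injective_iff_map_eq_zero]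
  intro z hz
  obtain ⟨z, rfl⟩ := LinearMap.lTensor_surjective (B →ₗ[R] W) hs.surj z
  rw [th_nat] at hz
  obtain ⟨ξ, hξ⟩ : ∃ ξ : (Z →ₗ[R] B) →ₗ[R] W, ξ ∘ₗ i.lcomp R B = th R B W _ z := by
    let ρ := i.lcomp R B
    have hk : LinearMap.ker ρ ≤ LinearMap.ker (th R B W _ z) := by
      intro α hα
      have h0 : LinearMap.ker p ≤ LinearMap.ker α := by
        intro x hx
        obtain ⟨w, rfl⟩ := (hs.exact x).1 hx
        exact LinearMap.congr_fun hα w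
      have h1 : p.lcomp R B (((LinearMap.ker p).liftQ α h0) ∘ₗ
        (p.quotKerEquivOfSurjective hs.surj).symm.toLinearMap) = α := by
        apply LinearMap.ext
        intro b
        have : (p.quotKerEquivOfSurjective hs.surj).symm (p b) = Submodule.Quotient.mk b := by
          rw [LinearEquiv.symm_apply_eq]; rfl
        simp [this]
      rw [← h1]
      exact LinearMap.congr_fun hz _
    obtain ⟨ξ, hξ⟩ := inj_extend hW ((LinearMap.ker ρ).liftQ ρ le_rfl)
      (LinearMap.ker_eq_bot.1 (Submodule.ker_liftQ_eq_bot _ _ _ le_rfl))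
      ((LinearMap.ker ρ).liftQ _ hk)
    refine ⟨ξ, ?_⟩
    apply LinearMap.ext
    intro α
    exact LinearMap.congr_fun hξ (Submodule.Quotient.mk α)
  obtain ⟨w, rfl⟩ := hZ ξ
  rw [← th_nat] at hξ
  rw [← (th_free n).1 hξ, ← LinearMap.comp_apply, ← LinearMap.lTensor_comp,
    hs.exact.linearMap_comp_eq_zero, LinearMap.lTensor_zero, LinearMap.zero_apply]

variable (R) in
theorem exists_syz [IsNoetherianRing R] (M : Type u) [AddCommGroup M] [Module R M]
    [Module.Finite R M] : ∃ (n : ℕ) (Z : ModuleCat.{u} R) (i : Z →ₗ[R] (Fin n → R))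
    (p : (Fin n → R) →ₗ[R] M), SES i p ∧ Module.Finite R Z := by
  obtain ⟨n, p, hp⟩ := Module.Finite.exists_fin' R M
  exact ⟨n, ModuleCat.of R (LinearMap.ker p), (LinearMap.ker p).subtype, p, SES.ker hp,
    inferInstanceAs (Module.Finite R (LinearMap.ker p))⟩

theorem th_bij [IsNoetherianRing R] (hW : Module.Injective R W) [Module.Finite R Y] :
    Function.Bijective (th R B W Y) := by
  obtain ⟨n, Z, i, p, hs, hZ⟩ := exists_syz R Y
  obtain ⟨m, q, hq⟩ := Module.Finite.exists_fin' R Z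
  exact ⟨th_inj hW hs (th_surj hW q hq), th_surj hW p hs.surj⟩

/-- direction one -/
theorem a7 [IsNoetherianRing R] (hW : Module.Injective R W)
    (hc : ∀ (A : Type u) [AddCommGroup A] [Module R A] (a : A), a ≠ 0 →
      ∃ φ : A →ₗ[R] W, φ a ≠ 0) (i : ℕ) :
    ∀ M : ModuleCat.{u} R, Module.Finite R M → EV R (B →ₗ[R] W) (M →ₗ[R] W) (i+1) →
    EV R M B (i+1) := by
  induction i with
  | zero =>
    intro M hM h
    obtain ⟨n, Z, i, p, hs, hZ⟩ := exists_syz R M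
    have hinj : Function.Injective (i.lTensor (B →ₗ[R] W)) := by
      rw [injective_iff_map_eq_zero]
      intro z hz
      by_contra hne
      obtain ⟨φ, hφ⟩ := hc _ z hne
      obtain ⟨ψ, hψ⟩ := (hs.hom_inj hW).lift h (TensorProduct.curry φ)
      have : TensorProduct.lift ψ ∘ₗ i.lTensor (B →ₗ[R] W) = φ := by
        ext b z
        exact LinearMap.congr_fun (LinearMap.congr_fun hψ b) z
      apply hφ
      rw [← this, LinearMap.comp_apply, hz, map_zero]
    refine hs.ev1_of_ext (EV.of_proj one_pos) fun φ => ?_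
    by_contra hne
    let N := LinearMap.range (i.lcomp R B)
    have : N.mkQ φ ≠ 0 := by
      rw [Submodule.mkQ_apply, Ne, Submodule.Quotient.mk_eq_zero]
      exact hne
    obtain ⟨ξ, hξ⟩ := hc _ _ this
    obtain ⟨z, hz⟩ := (th_bij (B := B) (Y := Z) hW).2 (ξ ∘ₗ N.mkQ)
    have h1 : th R B W _ (i.lTensor _ z) = 0 := by
      rw [th_nat, hz]
      ext α
      have : N.mkQ (i.lcomp R B α) = 0 := by
        rw [Submodule.mkQ_apply, Submodule.Quotient.mk_eq_zero]
        exact ⟨α, rfl⟩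
      change ξ (N.mkQ (i.lcomp R B α)) = 0
      rw [this, map_zero]
    have h2 : z = 0 := by
      apply hinj
      rw [map_zero]
      apply (th_free n).1
      rw [h1, map_zero]
    apply hξ
    rw [← LinearMap.comp_apply, ← hz, h2, map_zero, LinearMap.zero_apply]
  | succ j ih =>
    intro M hM h
    obtain ⟨n, Z, i, p, hs, hZ⟩ := exists_syz R M
    have := inj_hom (X := Fin n → R) hW
    exact hs.con3 (ih Z hZ ((hs.hom_inj hW).cov3 (EV.of_inj (by omega)) h)) (EV.of_proj (by omega))

theorem a7' [IsNoetherianRing R] (hW : Module.Injective R W) (I : Type u) [AddCommGroup I]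
    [Module R I] (hI : Module.Injective R I) (i : ℕ) :
    ∀ M : ModuleCat.{u} R, Module.Finite R M → EV R M R (i+1) →
    EV R (R →ₗ[R] I) (M →ₗ[R] W) (i+1) := by
  induction i with
  | zero =>
    intro M hM h
    obtain ⟨n, Z, i, p, hs, hZ⟩ := exists_syz R M
    have := inj_hom (X := Fin n → R) hW
    refine (hs.hom_inj hW).ev1_of_lift (EV.of_inj one_pos) fun φ => lift_hom hW i ?_ φ
    rw [injective_iff_map_eq_zero]
    intro z hz
    apply (th_bij (B := R) (Y := Z) hI).1
    have h1 := th_nat i z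
    rw [hz, map_zero] at h1
    rw [map_zero]
    ext α
    obtain ⟨β, hβ⟩ := hs.ext h α
    rw [← hβ]
    exact (LinearMap.congr_fun h1 β).symm
  | succ j ih =>
    intro M hM h
    obtain ⟨n, Z, i, p, hs, hZ⟩ := exists_syz R M
    have := inj_hom (X := Fin n → R) hW
    exact (hs.hom_inj hW).cov1 (ih Z hZ (hs.con1 (EV.of_proj (by omega)) h)) (EV.of_inj (by omega))

/-- injective cogenerator -/
theorem exists_cogen (R : Type u) [CommRing R] : ∃ W : ModuleCat.{u} R, Module.Injective R W ∧
    ∀ (A : Type u) [AddCommGroup A] [Module R A] (a : A), a ≠ 0 →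
      ∃ φ : A →ₗ[R] W, φ a ≠ 0 := by
  refine ⟨ModuleCat.of R (CharacterModule R), ?_, ?_⟩
  · exact Module.Flat.iff_characterModule_injective.1 inferInstance
  · intro A _ _ a ha
    obtain ⟨c, hc⟩ := CharacterModule.exists_character_apply_ne_zero_of_ne_zero ha
    refine ⟨{ toFun := fun a => c.comp (LinearMap.toSpanSingleton R A a).toAddMonoidHom
              map_add' := ?_
              map_smul' := ?_ }, fun h => hc ?_⟩
    · intro x y
      apply CharacterModule.ext
      intro r
      change c (r • (x + y)) = c (r • x) + c (r • y)
      rw [smul_add, map_add]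
    · intro s x
      apply CharacterModule.ext
      intro r
      change c (r • s • x) = c ((s * r) • x)
      rw [smul_smul, mul_comm]
    · have h1 := DFunLike.congr_fun (F := CharacterModule R) h 1
      change c ((1 : R) • a) = 0 at h1
      rwa [one_smul] at h1

/-- The key theorem A10. -/
theorem a10 [IsLocalRing R] [IsNoetherianRing R] [Module.Finite R M]
    (hR : GG.IsCMLocalRing R) (hM : GG.IsMaximalCM R M) (hG : ∃ n, GG.gfdLE R M n)
    (hX : Module.Injective R X) : LGI R (M →ₗ[R] X) := by
  obtain ⟨rs, hd, hm, hr1, hr2⟩ := common_seq hR hM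
  obtain ⟨W, hW, hc⟩ := exists_cogen R
  obtain ⟨n, hn⟩ := hG
  have hRW : Module.Injective R (R →ₗ[R] W) := inj_hom hW
  obtain ⟨S, hS, h4, ⟨n1, h5⟩, ⟨n2, h6⟩, h7, h8⟩ := red (M := M) hW rs (ModuleCat.of R R)
    (inferInstanceAs (Module.Finite R R)) hr1
    (((TensorProduct.lid R M).isWeaklyRegular_congr rs).2 hr2) hm
    ⟨0, fun B i hi => EV.of_proj hi⟩ ⟨0, FID.of_inj⟩ (fun i hi => EV.of_proj hi)
  have h9 : Module.supportDim R S = 0 := by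
    have : Module.supportDim R (ModuleCat.of R R) = ringKrullDim R :=
      Module.supportDim_self_eq_ringKrullDim R
    rw [this, ← hd] at h4
    revert h4
    generalize Module.supportDim R S = x
    intro h4
    induction x with
    | bot => simp at h4
    | coe x =>
      have : x + (rs.length : ℕ∞) = 0 + (rs.length : ℕ∞) := by
        rw [zero_add]; exact_mod_cast h4
      rw [ENat.add_left_injective_of_ne_top (ENat.natCast_ne_top rs.length) this]
      rfl
  obtain ⟨⟨t, ht⟩, j, hj⟩ := dim_zero (R := R) (A := S) h9
  have h10 := a6 hW hn h5 h6 h7 j hj ht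
  have h11 : EVp R M R := by
    intro i hi
    obtain ⟨k, rfl⟩ := Nat.exists_eq_succ_of_ne_zero hi.ne'
    exact h8 _ (a7 hW hc k (ModuleCat.of R M) ‹_› (h10 _ hi))
  refine gid_crit n (ModuleCat.of R (M →ₗ[R] X)) (gfd_gid hX n M hn) fun I hI i hi => ?_
  obtain ⟨k, rfl⟩ := Nat.exists_eq_succ_of_ne_zero hi.ne'
  exact (a7' hX I hI k (ModuleCat.of R M) ‹_› (h11 _ hi)).congr_left
    (LinearMap.ringLmapEquivSelf R R I)

end
end GP


namespace GP

section
variable {R : Type u} [CommRing R] {K M : Type u} [AddCommGroup K] [Module R K]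
    [AddCommGroup M] [Module R M]

/-- localization at a prime -/
abbrev loc (p : PrimeSpectrum R) (K : Type u) [AddCommGroup K] [Module R K] : Type u :=
  LocalizedModule p.asIdeal.primeCompl K

/-- canonical map -/
noncomputable abbrev lo (p : PrimeSpectrum R) (K : Type u) [AddCommGroup K] [Module R K] :
    K →ₗ[R] loc p K := LocalizedModule.mkLinearMap p.asIdeal.primeCompl K

theorem loc_inj {p : PrimeSpectrum R} {u : R} (hu : u ∉ p.asIdeal) {z : loc p K}
    (h : u • z = 0) : z = 0 :=
  (IsLocalizedModule.smul_injective (lo p K) (⟨u, hu⟩ : p.asIdeal.primeCompl)) (by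
    change u • z = u • (0 : loc p K)
    rw [h, smul_zero])

theorem loc_div {p : PrimeSpectrum R} {u : R} (hu : u ∉ p.asIdeal) (z : loc p K) :
    ∃ z' : loc p K, u • z' = z := by
  obtain ⟨z', h⟩ := ((Module.End.isUnit_iff _).1
    (IsLocalizedModule.map_units (lo p K) (⟨u, hu⟩ : p.asIdeal.primeCompl))).2 z
  exact ⟨z', h⟩

theorem loc_surj {p : PrimeSpectrum R} (z : loc p K) : ∃ t ∉ p.asIdeal, ∃ k : K, t • z = lo p K k := by
  obtain ⟨⟨k, t⟩, h⟩ := IsLocalizedModule.surj p.asIdeal.primeCompl (lo p K) z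
  exact ⟨t, t.2, k, h⟩

theorem loc_zero {p : PrimeSpectrum R} {k : K} (h : lo p K k = 0) : ∃ t ∉ p.asIdeal, t • k = 0 := by
  obtain ⟨t, h⟩ := (IsLocalizedModule.eq_zero_iff p.asIdeal.primeCompl (lo p K)).1 h
  exact ⟨t, t.2, h⟩

theorem loc_zero' {p : PrimeSpectrum R} {k : K} {t : R} (ht : t ∉ p.asIdeal) (h : t • k = 0) :
    lo p K k = 0 :=
  loc_inj ht (by rw [← map_smul, h, map_zero])

/-- elementwise support condition -/
def SuppIn (F : Set (PrimeSpectrum R)) (K : Type u) [AddCommGroup K] [Module R K] : Prop :=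
  ∀ q ∉ F, ∀ y : K, ∃ s ∉ q.asIdeal, s • y = 0

theorem suppIn_support : SuppIn (Module.support R K) K := by
  intro q hq y
  obtain ⟨r, hr, h⟩ := Module.notMem_support_iff'.1 hq y
  exact ⟨r, hr, h⟩

theorem tors {F : Set (PrimeSpectrum R)} (hF : SuppIn F K) {p : PrimeSpectrum R}
    (hp : ∀ q ∈ F, q ≤ p → q = p) {s : R} (hs : s ∈ p.asIdeal) (z : loc p K) :
    ∃ k : ℕ, s ^ k • z = 0 := by
  obtain ⟨t, ht, y, hy⟩ := loc_surj z
  by_contra! hne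
  have hd : Disjoint ((Submodule.span R {y}).annihilator : Set R)
      ((Submonoid.powers s ⊔ p.asIdeal.primeCompl : Submonoid R) : Set R) := by
    rw [Set.disjoint_left]
    intro a ha hb
    obtain ⟨b, ⟨k, rfl⟩, c, hc, rfl⟩ := Submonoid.mem_sup.1 hb
    rw [SetLike.mem_coe, Submodule.mem_annihilator_span_singleton] at ha
    apply hne k
    have hct : c * t ∉ p.asIdeal := fun h => (p.2.mem_or_mem h).elim hc ht
    apply loc_inj hct
    rw [smul_smul, mul_comm, mul_smul, mul_smul, hy, ← map_smul, ← map_smul, smul_smul]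
    have : (s ^ k * c) • y = 0 := ha
    rw [this, map_zero]
  obtain ⟨Q, hQ, hle, hdis⟩ := Ideal.exists_le_prime_disjoint _ _ hd
  let q : PrimeSpectrum R := ⟨Q, hQ⟩
  have hqp : q ≤ p := by
    intro a ha
    by_contra hap
    exact Set.disjoint_left.1 hdis ha ((le_sup_right : _ ≤ Submonoid.powers s ⊔ _) hap)
  have hqF : q ∈ F := by
    by_contra hqF
    obtain ⟨v, hv, hvy⟩ := hF q hqF y
    exact hv (hle (Submodule.mem_annihilator_span_singleton _ _ |>.2 hvy))
  have hsq : s ∉ q.asIdeal := fun h => Set.disjoint_left.1 hdis h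
    ((le_sup_left : Submonoid.powers s ≤ _) (Submonoid.mem_powers s))
  rw [hp q hqF hqp] at hsq
  exact hsq hs

theorem fin_kill {ι : Type*} {A : ι → Type*} [∀ i, AddCommGroup (A i)] [∀ i, Module R (A i)]
    (f : ∀ i, A i) (q : PrimeSpectrum R) (T : Finset ι)
    (h : ∀ i ∈ T, ∃ s ∉ q.asIdeal, s • f i = 0) : ∃ s ∉ q.asIdeal, ∀ i ∈ T, s • f i = 0 := by
  classical
  induction T using Finset.induction_on with
  | empty => exact ⟨1, q.2.one_notMem, by simp⟩
  | insert a T ha ih =>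
    obtain ⟨s, hs, h1⟩ := ih fun i hi => h i (by simp [hi])
    obtain ⟨t, ht, h2⟩ := h a (by simp)
    refine ⟨s * t, fun hst => (q.2.mem_or_mem hst).elim hs ht, ?_⟩
    intro i hi
    rcases Finset.mem_insert.1 hi with rfl | hi
    · rw [mul_smul, h2, smul_zero]
    · rw [mul_comm, mul_smul, h1 i hi, smul_zero]

theorem fin_kill' {ι : Type*} {A : ι → Type*} [∀ i, AddCommGroup (A i)] [∀ i, Module R (A i)]
    (f : ∀ i, A i) (q : PrimeSpectrum R) (hT : {i | f i ≠ 0}.Finite)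
    (h : ∀ i, f i ≠ 0 → ∃ s ∉ q.asIdeal, s • f i = 0) : ∃ s ∉ q.asIdeal, ∀ i, s • f i = 0 := by
  obtain ⟨s, hs, h1⟩ := fin_kill f q hT.toFinset (fun i hi => h i (by simpa using hi))
  refine ⟨s, hs, fun i => ?_⟩
  by_cases hi : f i = 0
  · rw [hi, smul_zero]
  · exact h1 i (by simpa using hi)

theorem kill_of_not_le {F : Set (PrimeSpectrum R)} (hF : SuppIn F K) {p q : PrimeSpectrum R}
    (hp : ∀ q ∈ F, q ≤ p → q = p) (hpq : ¬ p ≤ q) (z : loc p K) :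
    ∃ s ∉ q.asIdeal, s • z = 0 := by
  obtain ⟨s, hs, hsq⟩ := Set.not_subset.1 (show ¬ (p.asIdeal : Set R) ⊆ q.asIdeal from hpq)
  obtain ⟨k, hk⟩ := tors hF hp hs z
  exact ⟨s ^ k, fun h => hsq (q.2.mem_of_pow_mem _ h), hk⟩

theorem mem_finSupp {S : Set (PrimeSpectrum R)} {f : GG.locProd R S K} :
    f ∈ GG.finSupp R S K ↔ {p : S | f p ≠ 0}.Finite := Iff.rfl

theorem suppIn_next {F G : Set (PrimeSpectrum R)} (hF : SuppIn F K)
    (hmin : ∀ p ∈ F \ G, ∀ q ∈ F, q ≤ p → q = p)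
    (hr : LinearMap.range (GG.thetaFull R (F \ G) K) ≤ GG.finSupp R (F \ G) K) :
    SuppIn G (GG.nextKType R (F \ G) K) := by
  intro q hq y
  obtain ⟨c, rfl⟩ := Submodule.mkQ_surjective _ y
  -- it suffices to kill `u c - θ k`
  suffices h : ∃ s ∉ q.asIdeal, ∃ k : K, s • c.1 = GG.thetaFull R (F \ G) K k by
    obtain ⟨s, hs, k, hk⟩ := h
    refine ⟨s, hs, ?_⟩
    rw [← map_smul, Submodule.mkQ_apply, Submodule.Quotient.mk_eq_zero]
    exact ⟨k, hk.symm⟩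
  by_cases hqF : q ∈ F
  · have hqS : q ∈ F \ G := ⟨hqF, hq⟩
    obtain ⟨t, ht, k, hk⟩ := loc_surj (c.1 ⟨q, hqS⟩)
    let f : GG.locProd R (F \ G) K := t • c.1 - GG.thetaFull R (F \ G) K k
    have hf : f ∈ GG.finSupp R (F \ G) K :=
      Submodule.sub_mem _ (Submodule.smul_mem _ _ c.2) (hr ⟨k, rfl⟩)
    obtain ⟨s, hs, h⟩ := fin_kill' f q hf (by
      intro p hp
      have hpq : ¬ p.1 ≤ q := by
        intro hle
        have := hmin q hqS p.1 p.2.1 hle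
        apply hp
        have hpe : p = ⟨q, hqS⟩ := Subtype.ext this
        rw [hpe]
        change t • c.1 ⟨q, hqS⟩ - lo q K k = 0
        rw [hk, sub_self]
      exact kill_of_not_le hF (hmin p.1 p.2) hpq (f p))
    refine ⟨s * t, fun hst => (q.2.mem_or_mem hst).elim hs ht, s • k, ?_⟩
    have : s • f = 0 := funext h
    rw [mul_smul, map_smul, ← sub_eq_zero, ← smul_sub]
    exact this
  · obtain ⟨s, hs, h⟩ := fin_kill' c.1 q c.2 (by
      intro p _
      obtain ⟨t, ht, k, hk⟩ := loc_surj (c.1 p)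
      obtain ⟨s, hs, hsk⟩ := hF q hqF k
      refine ⟨s, hs, loc_inj ht ?_⟩
      rw [smul_comm, hk, ← map_smul, hsk, map_zero])
    refine ⟨s, hs, 0, ?_⟩
    rw [map_zero]
    exact funext h

/-- components of a hom -/
noncomputable def cmp {S : Set (PrimeSpectrum R)} (p : S) :
    (M →ₗ[R] GG.finSupp R S K) →ₗ[R] (M →ₗ[R] loc p.1 K) :=
  LinearMap.llcomp R M (GG.finSupp R S K) (loc p.1 K)
    (LinearMap.proj (φ := fun p : S => loc p.1 K) p ∘ₗ (GG.finSupp R S K).subtype)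

theorem cmp_apply {S : Set (PrimeSpectrum R)} (p : S) (c : M →ₗ[R] GG.finSupp R S K) (m : M) :
    cmp p c m = (c m).1 p := rfl

theorem cmp_ext {S : Set (PrimeSpectrum R)} {c : M →ₗ[R] GG.finSupp R S K}
    (h : ∀ p, cmp p c = 0) : c = 0 := by
  ext m p
  exact LinearMap.congr_fun (h p) m

theorem cmp_finite [Module.Finite R M] {S : Set (PrimeSpectrum R)}
    (c : M →ₗ[R] GG.finSupp R S K) : {p : S | cmp p c ≠ 0}.Finite := by
  obtain ⟨T, hT⟩ := Module.Finite.fg_top (R := R) (M := M)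
  refine (T.finite_toSet.biUnion fun m _ => (c m).2).subset ?_
  intro p hp
  by_contra h
  apply hp
  apply LinearMap.ext_on (s := (T : Set M)) hT
  intro m hm
  by_contra hne
  exact h (Set.mem_biUnion hm hne)

theorem hom_kill_of_not_le [Module.Finite R M] {F : Set (PrimeSpectrum R)} (hF : SuppIn F K)
    {p q : PrimeSpectrum R}
    (hp : ∀ q ∈ F, q ≤ p → q = p) (hpq : ¬ p ≤ q) (z : M →ₗ[R] loc p K) :
    ∃ s ∉ q.asIdeal, s • z = 0 := by
  obtain ⟨T, hT⟩ := Module.Finite.fg_top (R := R) (M := M)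
  obtain ⟨s, hs, h⟩ := fin_kill (A := fun _ : M => loc p K) (fun m => z m) q T
    (fun m _ => kill_of_not_le hF hp hpq (z m))
  refine ⟨s, hs, ?_⟩
  apply LinearMap.ext_on (s := (T : Set M)) hT
  intro m hm
  exact h m hm

theorem hom_loc_inj {p : PrimeSpectrum R} {u : R} (hu : u ∉ p.asIdeal) {z : M →ₗ[R] loc p K}
    (h : u • z = 0) : z = 0 := by
  ext m
  exact loc_inj hu (LinearMap.congr_fun h m)

theorem hom_loc_div {p : PrimeSpectrum R} {u : R} (hu : u ∉ p.asIdeal) (z : M →ₗ[R] loc p K) :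
    ∃ z' : M →ₗ[R] loc p K, u • z' = z := by
  have hb : Function.Bijective (u • (LinearMap.id : loc p K →ₗ[R] loc p K)) := by
    refine ⟨(injective_iff_map_eq_zero _).2 fun z hz => loc_inj hu hz, fun z => loc_div hu z⟩
  let e := LinearEquiv.ofBijective _ hb
  refine ⟨e.symm.toLinearMap ∘ₗ z, ?_⟩
  ext m
  exact e.apply_symm_apply (z m)

theorem hom_loc_surj [Module.FinitePresentation R M] {p : PrimeSpectrum R} (z : M →ₗ[R] loc p K) :
    ∃ t ∉ p.asIdeal, ∃ k : M →ₗ[R] K, t • z = lo p K ∘ₗ k := by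
  obtain ⟨k, t, h⟩ := Module.FinitePresentation.exists_lift_of_isLocalizedModule
    p.asIdeal.primeCompl (lo p K) z
  exact ⟨t, t.2, k, h.symm⟩

/-- the hom with one component -/
theorem exists_cmp {S : Set (PrimeSpectrum R)} (p : S) (z : M →ₗ[R] loc p.1 K) :
    ∃ c : M →ₗ[R] GG.finSupp R S K, cmp p c = z ∧ ∀ q, q ≠ p → cmp q c = 0 := by
  classical
  refine ⟨LinearMap.codRestrict _ (LinearMap.single R (fun p : S => loc p.1 K) p ∘ₗ z) ?_, ?_, ?_⟩
  · intro m
    refine (Set.finite_singleton p).subset ?_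
    intro q hq
    by_contra h
    exact hq (Pi.single_eq_of_ne h _)
  · ext m
    exact Pi.single_eq_same (M := fun p : S => loc p.1 K) p (z m)
  · intro q hq
    ext m
    exact Pi.single_eq_of_ne (M := fun p : S => loc p.1 K) hq (z m)

end
end GP


namespace GP

section
variable {R : Type u} [CommRing R] {K C : Type u} [AddCommGroup K] [Module R K]
    [AddCommGroup C] [Module R C]

theorem step_loc (p : PrimeSpectrum R) (e : K →ₗ[R] C) (he : Function.Injective e)
    (hq : ∀ c : C, ∃ u ∉ p.asIdeal, ∃ k, u • c = e k) :
    ∃ π : C →ₗ[R] loc p K, π ∘ₗ e = lo p K ∧ ∀ c, π c = 0 ↔ ∃ u ∉ p.asIdeal, u • c = 0 := by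
  have : IsLocalizedModule p.asIdeal.primeCompl (lo p C ∘ₗ e) := by
    refine ⟨fun x => IsLocalizedModule.map_units (lo p C) x, fun y => ?_, fun {a b} hab => ?_⟩
    · obtain ⟨t, ht, c, hc⟩ := loc_surj y
      obtain ⟨u, hu, k, hk⟩ := hq c
      refine ⟨⟨k, ⟨u * t, fun hst => (p.2.mem_or_mem hst).elim hu ht⟩⟩, ?_⟩
      change (u * t) • y = lo p C (e k)
      rw [mul_smul, hc, ← hk, map_smul]
    · have h1 : lo p C (e (a - b)) = 0 := by
        rw [map_sub, map_sub, sub_eq_zero]; exact hab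
      obtain ⟨t, ht, h⟩ := loc_zero h1
      refine ⟨⟨t, ht⟩, ?_⟩
      rw [← map_smul] at h
      have h2 : t • (a - b) = 0 := he (by rw [h, map_zero])
      rw [smul_sub, sub_eq_zero] at h2
      exact h2
  let E : loc p K ≃ₗ[R] loc p C := IsLocalizedModule.iso p.asIdeal.primeCompl (lo p C ∘ₗ e)
  refine ⟨E.symm.toLinearMap ∘ₗ lo p C, ?_, fun c => ?_⟩
  · ext k
    change E.symm (lo p C (e k)) = lo p K k
    exact LinearMap.congr_fun (IsLocalizedModule.iso_symm_comp p.asIdeal.primeCompl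
      (lo p C ∘ₗ e)) k
  · constructor
    · intro h
      have h1 : lo p C c = 0 := E.symm.injective (by rw [map_zero]; exact h)
      exact loc_zero h1
    · rintro ⟨u, hu, h⟩
      change E.symm (lo p C c) = 0
      rw [loc_zero' hu h, map_zero]

theorem step (S : Set (PrimeSpectrum R)) (e : K →ₗ[R] C) (he : Function.Injective e)
    (hq : ∀ p ∈ S, ∀ c : C, ∃ u ∉ p.asIdeal, ∃ k, u • c = e k)
    (h1 : ∀ c : C, c ≠ 0 → ∃ p ∈ S, ∀ u ∉ p.asIdeal, u • c ≠ 0)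
    (h2 : ∀ c : C, {p : S | ∀ u ∉ p.1.asIdeal, u • c ≠ 0}.Finite)
    (h3 : ∀ p ∈ S, ∀ c : C, ∀ u ∉ p.asIdeal, ∃ c' : C, (∃ v ∉ p.asIdeal, v • (u • c' - c) = 0) ∧
      ∀ p' ∈ S, p' ≠ p → ∃ w ∉ p'.asIdeal, w • c' = 0) :
    ∃ E : C ≃ₗ[R] GG.finSupp R S K, ∀ k, (E (e k)).1 = GG.thetaFull R S K k := by
  classical
  choose π hπ hπ0 using fun p : S => step_loc p.1 e he (hq p.1 p.2)
  have hmem : ∀ c, LinearMap.pi (φ := fun p : S => loc p.1 K) π c ∈ GG.finSupp R S K := by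
    intro c
    refine (h2 c).subset ?_
    intro p hp u hu h
    exact hp ((hπ0 p c).2 ⟨u, hu, h⟩)
  let Φ : C →ₗ[R] GG.finSupp R S K := LinearMap.codRestrict _ _ hmem
  have hΦ : ∀ c p, (Φ c).1 p = π p c := fun _ _ => rfl
  have hinj : Function.Injective Φ := by
    rw [injective_iff_map_eq_zero]
    intro c hc
    by_contra hne
    obtain ⟨p, hp, h⟩ := h1 c hne
    have : π ⟨p, hp⟩ c = 0 := by
      rw [← hΦ, hc]; rfl
    obtain ⟨u, hu, h'⟩ := (hπ0 ⟨p, hp⟩ c).1 this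
    exact h u hu h'
  have hsingle : ∀ (p : S) (z : loc p.1 K), ∃ c, ∀ q, π q c = Pi.single (M := fun p : S => loc p.1 K) p z q := by
    intro p z
    obtain ⟨t, ht, k, hk⟩ := loc_surj z
    obtain ⟨c', ⟨v, hv, hvc⟩, hc'⟩ := h3 p.1 p.2 (e k) t ht
    refine ⟨c', fun q => ?_⟩
    by_cases hqp : q = p
    · subst hqp
      rw [Pi.single_eq_same]
      have h4 : π q (t • c' - e k) = 0 := (hπ0 q _).2 ⟨v, hv, hvc⟩
      have h5 : π q (e k) = t • z := by rw [hk]; exact LinearMap.congr_fun (hπ q) k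
      rw [map_sub, map_smul, h5, ← smul_sub] at h4
      exact sub_eq_zero.1 (loc_inj ht h4)
    · rw [Pi.single_eq_of_ne hqp]
      exact (hπ0 q _).2 (hc' q.1 q.2 fun h => hqp (Subtype.ext h))
  have hsurj : Function.Surjective Φ := by
    rintro ⟨f, hf⟩
    choose cc hcc using hsingle
    refine ⟨∑ p ∈ hf.toFinset, cc p (f p), ?_⟩
    apply Subtype.ext
    funext q
    rw [hΦ, map_sum]
    simp_rw [hcc]
    by_cases hfq : f q = 0
    · rw [hfq]
      refine Finset.sum_eq_zero fun p hp => ?_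
      refine Pi.single_eq_of_ne ?_ _
      rintro rfl
      exact (hf.mem_toFinset.1 hp) hfq
    · rw [Finset.sum_eq_single q]
      · exact Pi.single_eq_same _ _
      · intro p _ hpq
        exact Pi.single_eq_of_ne hpq.symm _
      · intro h
        exact absurd (hf.mem_toFinset.2 hfq) h
  refine ⟨LinearEquiv.ofBijective Φ ⟨hinj, hsurj⟩, fun k => ?_⟩
  funext p
  exact LinearMap.congr_fun (hπ p) k

theorem step_cons (S : Set (PrimeSpectrum R)) (e : K →ₗ[R] C) (he : Function.Injective e)
    (E : C ≃ₗ[R] GG.finSupp R S K) (hE : ∀ k, (E (e k)).1 = GG.thetaFull R S K k) :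
    Function.Injective (GG.thetaFull R S K) ∧
    LinearMap.range (GG.thetaFull R S K) ≤ GG.finSupp R S K ∧
    Nonempty ((C ⧸ LinearMap.range e) ≃ₗ[R] GG.nextKType R S K) := by
  refine ⟨fun a b hab => ?_, ?_, ⟨Submodule.Quotient.equiv _ _ E ?_⟩⟩
  · rw [← hE, ← hE] at hab
    exact he (E.injective (Subtype.ext hab))
  · rintro _ ⟨k, rfl⟩
    rw [← hE]
    exact (E (e k)).2
  · ext x
    constructor
    · rintro ⟨_, ⟨k, rfl⟩, rfl⟩
      exact ⟨k, (hE k).symm⟩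
    · rintro ⟨k, hk⟩
      refine ⟨e k, ⟨k, rfl⟩, ?_⟩
      apply Subtype.ext
      exact (hE k).trans hk

end
end GP


namespace GP

section
variable {R : Type u} [CommRing R] {F : ℕ → Set (PrimeSpectrum R)} {N : ModuleCat.{u} R}
    {P : ModuleCat.{u} R → Prop}

/-- the canonical map into the n-th Cousin term -/
noncomputable def cj (hr : ∀ n, LinearMap.range (GG.cousinTheta R F N n) ≤
      GG.finSupp R (F n \ F (n + 1)) (GG.cousinK R F N n)) (n : ℕ) :
    GG.cousinK R F N n →ₗ[R] GG.cousinC R F N n :=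
  LinearMap.codRestrict _ (GG.cousinTheta R F N n) fun x => hr n ⟨x, rfl⟩

/-- the canonical projection from the n-th Cousin term -/
noncomputable def cq (F : ℕ → Set (PrimeSpectrum R)) (N : ModuleCat.{u} R) (n : ℕ) :
    GG.cousinC R F N n →ₗ[R] GG.cousinK R F N (n + 1) :=
  Submodule.mkQ (Submodule.comap (GG.finSupp R (F n \ F (n + 1)) (GG.cousinK R F N n)).subtype
      (LinearMap.range (GG.thetaFull R (F n \ F (n + 1)) (GG.cousinK R F N n))))

theorem cq_surj (n : ℕ) : Function.Surjective (cq F N n) := Submodule.mkQ_surjective _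

theorem cq_ker (n : ℕ) : LinearMap.ker (cq F N n) =
    Submodule.comap (GG.finSupp R (F n \ F (n + 1)) (GG.cousinK R F N n)).subtype
      (LinearMap.range (GG.cousinTheta R F N n)) := Submodule.ker_mkQ _

theorem cousin_inj (h : GG.CousinResolves R F N P) (n : ℕ) :
    Function.Injective (GG.cousinTheta R F N n) := by
  cases n with
  | zero => exact h.2.1
  | succ n =>
    rw [injective_iff_map_eq_zero]
    intro x hx
    obtain ⟨y, rfl⟩ := cq_surj n x
    have h1 : y ∈ LinearMap.ker (GG.cousinD R F N n) := hx
    rw [h.2.2.1 n, ← cq_ker] at h1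
    exact h1

theorem cousin_of_inj (hr : ∀ n, LinearMap.range (GG.cousinTheta R F N n) ≤
      GG.finSupp R (F n \ F (n + 1)) (GG.cousinK R F N n))
    (hi : ∀ n, Function.Injective (GG.cousinTheta R F N n))
    (hP : ∀ n, P (ModuleCat.of R (GG.cousinC R F N n))) : GG.CousinResolves R F N P := by
  refine ⟨hr, hi 0, fun n => ?_, hP⟩
  rw [← cq_ker]
  ext y
  constructor
  · intro h
    exact hi (n + 1) (by rw [map_zero]; exact h)
  · intro h
    change GG.cousinTheta R F N (n + 1) (cq F N n y) = 0
    rw [LinearMap.mem_ker.1 h, map_zero]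

theorem cousin_ses (hr : ∀ n, LinearMap.range (GG.cousinTheta R F N n) ≤
      GG.finSupp R (F n \ F (n + 1)) (GG.cousinK R F N n))
    (hi : ∀ n, Function.Injective (GG.cousinTheta R F N n)) (n : ℕ) :
    SES (cj hr n) (cq F N n) := by
  refine ⟨fun a b hab => hi n (congrArg Subtype.val hab), ?_, cq_surj n⟩
  intro y
  rw [← LinearMap.mem_ker, cq_ker]
  constructor
  · rintro ⟨x, hx⟩
    exact ⟨x, Subtype.ext hx⟩
  · rintro ⟨x, rfl⟩
    exact ⟨x, rfl⟩

theorem cousin_suppIn (hF : GG.IsFiltration R F) (h0 : SuppIn (F 0) N)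
    (hr : ∀ n, LinearMap.range (GG.cousinTheta R F N n) ≤
      GG.finSupp R (F n \ F (n + 1)) (GG.cousinK R F N n)) (n : ℕ) :
    SuppIn (F n) (GG.cousinK R F N n) := by
  induction n with
  | zero => exact h0
  | succ n ih => exact suppIn_next ih (hF.2 n) (hr n)

theorem htM_eq {A : Type u} [AddCommGroup A] [Module R A] {p : PrimeSpectrum R}
    (h : p ∈ Module.support R A) :
    GG.htM R A p = Order.height (⟨p, h⟩ : ↥(Module.support R A)) := by
  unfold GG.htM
  exact iSup_pos h

theorem htM_lt {A : Type u} [AddCommGroup A] [Module R A] {p q : PrimeSpectrum R}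
    (hp : p ∈ Module.support R A) (hq : q ∈ Module.support R A) (hpq : p < q) :
    GG.htM R A p + 1 ≤ GG.htM R A q := by
  rw [htM_eq hp, htM_eq hq]
  exact Order.height_add_one_le (a := (⟨p, hp⟩ : ↥(Module.support R A))) (b := ⟨q, hq⟩) hpq

theorem htM_mono {A B : Type u} [AddCommGroup A] [Module R A] [AddCommGroup B] [Module R B]
    (h : Module.support R A ⊆ Module.support R B) {p : PrimeSpectrum R}
    (hp : p ∈ Module.support R A) : GG.htM R A p ≤ GG.htM R B p := by
  rw [htM_eq hp, htM_eq (h hp)]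
  exact Order.height_le_height_apply_of_strictMono
    (Set.inclusion h) (fun a b hab => hab) (⟨p, hp⟩ : ↥(Module.support R A))

theorem hf_filt (A : Type u) [AddCommGroup A] [Module R A] :
    GG.IsFiltration R (GG.heightFiltration R A) := by
  refine ⟨fun n p hp => ⟨hp.1, le_trans (by exact_mod_cast Nat.le_succ n) hp.2⟩, ?_⟩
  rintro n p ⟨hp, hp'⟩ q hq hqp
  by_contra hne
  refine hp' ⟨hp.1, ?_⟩
  refine le_trans ?_ (htM_lt hq.1 hp.1 (lt_of_le_of_ne hqp hne))
  push_cast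
  gcongr
  exact hq.2

theorem hf_zero (A : Type u) [AddCommGroup A] [Module R A] :
    GG.heightFiltration R A 0 = Module.support R A := by
  ext p
  exact ⟨fun h => h.1, fun h => ⟨h, by simp⟩⟩

theorem hf_mem {A : Type u} [AddCommGroup A] [Module R A] {n : ℕ} {p : PrimeSpectrum R} :
    p ∈ GG.heightFiltration R A n \ GG.heightFiltration R A (n + 1) ↔
      p ∈ Module.support R A ∧ GG.htM R A p = n := by
  constructor
  · rintro ⟨hp, hp'⟩
    refine ⟨hp.1, le_antisymm ?_ hp.2⟩
    by_contra hne
    refine hp' ⟨hp.1, ?_⟩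
    push_cast
    exact Order.add_one_le_of_lt (not_le.1 hne)
  · rintro ⟨hp, h⟩
    refine ⟨⟨hp, h.ge⟩, fun h' => ?_⟩
    have := h'.2
    rw [h] at this
    exact absurd (by exact_mod_cast this : n + 1 ≤ n) (by omega)

theorem hf_empty (A : Type u) [AddCommGroup A] [Module R A] {n : ℕ}
    (h : ringKrullDim R < n) : GG.heightFiltration R A n = ∅ := by
  rw [Set.eq_empty_iff_forall_notMem]
  rintro p ⟨hp, h'⟩
  rw [htM_eq hp] at h'
  have h1 : Order.height (⟨p, hp⟩ : ↥(Module.support R A)) ≤ Order.height p :=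
    Order.height_le_height_apply_of_strictMono
      (Subtype.val : ↥(Module.support R A) → PrimeSpectrum R) (fun a b hab => hab) ⟨p, hp⟩
  have h2 : ((n : ℕ∞) : WithBot ℕ∞) ≤ ringKrullDim R :=
    le_trans (WithBot.coe_le_coe.2 (h'.trans h1)) (Order.height_le_krullDim p)
  exact absurd (lt_of_lt_of_le h h2) (lt_irrefl _)

end
end GP


namespace GP

section
variable {R : Type u} [CommRing R] {K M : Type u} [AddCommGroup K] [Module R K]
    [AddCommGroup M] [Module R M]

theorem kill_cmp [Module.Finite R M] {S : Set (PrimeSpectrum R)} (q : PrimeSpectrum R)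
    (c : M →ₗ[R] GG.finSupp R S K)
    (h : ∀ r : S, cmp r c ≠ 0 → ∃ s ∉ q.asIdeal, s • cmp r c = 0) :
    ∃ s ∉ q.asIdeal, s • c = 0 := by
  obtain ⟨s, hs, h1⟩ := fin_kill' (fun r => cmp r c) q (cmp_finite c) h
  refine ⟨s, hs, cmp_ext fun r => ?_⟩
  rw [map_smul]
  exact h1 r

theorem suppIn_empty [IsLocalRing R] (h : SuppIn (∅ : Set (PrimeSpectrum R)) K) (y : K) :
    y = 0 := by
  obtain ⟨s, hs, hy⟩ := h (IsLocalRing.closedPoint R) (Set.notMem_empty _) y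
  have hu : IsUnit s := by
    by_contra hn
    exact hs ((IsLocalRing.mem_maximalIdeal s).2 hn)
  exact (hu.smul_eq_zero).1 hy

theorem support_hom [IsNoetherianRing R] [Module.Finite R M] [Module.Finite R K] :
    Module.support R (M →ₗ[R] K) ⊆ Module.support R K := by
  intro p hp
  rw [Module.mem_support_iff_of_finite] at hp ⊢
  refine le_trans (fun a ha => ?_) hp
  rw [Module.mem_annihilator] at ha ⊢
  intro φ
  ext m
  exact ha (φ m)

end

section
variable {R : Type u} [CommRing R] {M : Type u} [AddCommGroup M] [Module R M]
    {N : ModuleCat.{u} R}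

theorem chain [IsNoetherianRing R] [Module.Finite R M] [Module.Finite R N]
    (hr : ∀ n, LinearMap.range (GG.cousinTheta R (GG.heightFiltration R N) N n) ≤
      GG.finSupp R (GG.heightFiltration R N n \ GG.heightFiltration R N (n + 1))
        (GG.cousinK R (GG.heightFiltration R N) N n))
    (hl : ∀ n (φ : M →ₗ[R] GG.cousinK R (GG.heightFiltration R N) N (n + 1)),
      ∃ ψ : M →ₗ[R] GG.cousinC R (GG.heightFiltration R N) N n, cq _ N n ∘ₗ ψ = φ) (n : ℕ) :
    ∀ q ∈ GG.heightFiltration R N n \ GG.heightFiltration R N (n + 1),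
    ∀ z : M →ₗ[R] loc q (GG.cousinK R (GG.heightFiltration R N) N n), z ≠ 0 →
      q ∈ GG.heightFiltration R (M →ₗ[R] N) n \ GG.heightFiltration R (M →ₗ[R] N) (n + 1) := by
  have hfp : Module.FinitePresentation R M := Module.finitePresentation_of_finite R M
  have hsupp : ∀ n, SuppIn (GG.heightFiltration R N n)
      (GG.cousinK R (GG.heightFiltration R N) N n) :=
    cousin_suppIn (hf_filt N) (by rw [hf_zero]; exact suppIn_support) hr
  induction n with
  | zero =>
    intro q hq z hz
    obtain ⟨t, ht, k, hk⟩ := hom_loc_surj z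
    have hqH : q ∈ Module.support R (M →ₗ[R] N) := by
      by_contra hqn
      obtain ⟨s, hs, h⟩ := suppIn_support q hqn k
      refine hz (hom_loc_inj ht ?_)
      rw [hk]
      ext m
      exact loc_zero' hs (LinearMap.congr_fun h m)
    rw [hf_mem] at hq ⊢
    refine ⟨hqH, le_antisymm ((htM_mono support_hom hqH).trans hq.2.le) (by simp)⟩
  | succ n ih =>
    intro q hq z hz
    obtain ⟨t, ht, k, hk⟩ := hom_loc_surj z
    obtain ⟨ψ, hψ⟩ := hl n k
    have : ∃ r : ↥(GG.heightFiltration R N n \ GG.heightFiltration R N (n + 1)),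
        cmp r ψ ≠ 0 ∧ r.1 ≤ q := by
      by_contra! hcon
      obtain ⟨s, hs, h⟩ := kill_cmp q ψ (fun r hr0 =>
        hom_kill_of_not_le (hsupp n) ((hf_filt N).2 n r.1 r.2) (hcon r hr0) _)
      have h' : s • k = 0 := by
        rw [← hψ, ← LinearMap.comp_smul, h, LinearMap.comp_zero]
      refine hz (hom_loc_inj ht ?_)
      rw [hk]
      ext m
      exact loc_zero' hs (LinearMap.congr_fun h' m)
    obtain ⟨r, hr0, hrq⟩ := this
    have h1 := ih r.1 r.2 _ hr0
    have h2 := r.2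
    rw [hf_mem] at h1 h2 hq ⊢
    have hne : r.1 ≠ q := by
      intro h
      rw [h, hq.2] at h2
      exact absurd (by exact_mod_cast h2.2 : n + 1 = n) (by omega)
    have hqH := Module.mem_support_mono hrq h1.1
    refine ⟨hqH, le_antisymm ((htM_mono support_hom hqH).trans hq.2.le) ?_⟩
    have h3 := htM_lt h1.1 hqH (lt_of_le_of_ne hrq hne)
    rw [h1.2] at h3
    push_cast
    exact h3

theorem fid_N [IsLocalRing R] {d : ℕ} (hd : ringKrullDim R = d)
    (h : GG.CousinResolves R (GG.heightFiltration R N) N (fun X => Module.Injective R X)) :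
    FID R d N := by
  have hs := cousin_ses h.1 (cousin_inj h)
  have hsupp : ∀ n, SuppIn (GG.heightFiltration R N n)
      (GG.cousinK R (GG.heightFiltration R N) N n) :=
    cousin_suppIn (hf_filt N) (by rw [hf_zero]; exact suppIn_support) h.1
  have hz : ∀ y : GG.cousinK R (GG.heightFiltration R N) N (d + 1), y = 0 := by
    have h1 := hsupp (d + 1)
    rw [hf_empty N (n := d + 1) (by rw [hd]; exact_mod_cast Nat.lt_succ_self d)] at h1
    exact suppIn_empty h1
  have key : ∀ j i, i + j = d → FID R j (GG.cousinK R (GG.heightFiltration R N) N i) := by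
    intro j
    induction j with
    | zero =>
      intro i hi
      obtain rfl : i = d := hi
      have hb : Function.Bijective (cj h.1 i) := by
        refine ⟨(hs i).inj, fun y => ?_⟩
        exact ((hs i).exact y).1 (hz _)
      intro A k hk
      have := h.2.2.2 i
      exact (EV.of_inj hk : EV R A (GG.cousinC R (GG.heightFiltration R N) N i) k).congr_right
        (LinearEquiv.ofBijective _ hb).symm
    | succ j ih =>
      intro i hi
      exact FID.left (hs i) (h.2.2.2 i) (ih (i + 1) (by omega))
  exact key d 0 (by omega)

theorem ev_K [IsLocalRing R] [IsNoetherianRing R] [Module.Finite R M] [Module.Finite R N]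
    (hR : GG.IsCMLocalRing R) (hM : GG.IsMaximalCM R M)
    (h : GG.CousinResolves R (GG.heightFiltration R N) N (fun X => Module.Injective R X)) (n : ℕ) :
    EVp R M (GG.cousinK R (GG.heightFiltration R N) N n) := by
  have hs := cousin_ses h.1 (cousin_inj h)
  obtain ⟨rs, hd, hm, -, hr⟩ := common_seq hR hM
  induction n with
  | zero =>
    intro i hi
    have hY : FID R rs.length N := fid_N hd.symm h
    exact ev_depth hY rs (ModuleCat.of R M) inferInstance hr hm i (by omega)
  | succ n ih =>
    intro i hi
    have := h.2.2.2 n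
    exact (hs n).cov3 (EV.of_inj hi) (ih _ (by omega))

theorem exists_quot [IsLocalRing R] [Module.Finite R M] [Nontrivial M] :
    ∃ f : M →ₗ[R] R ⧸ IsLocalRing.maximalIdeal R, Function.Surjective f := by
  obtain ⟨W, hW⟩ := (IsCoatomic.exists_coatom (Submodule R M))
  have : IsSimpleModule R (M ⧸ W) := isSimpleModule_iff_isCoatom.2 hW
  obtain ⟨I, hI, ⟨e⟩⟩ := isSimpleModule_iff_quot_maximal.1 this
  obtain rfl := IsLocalRing.eq_maximalIdeal hI
  exact ⟨e.toLinearMap ∘ₗ W.mkQ, e.surjective.comp W.mkQ_surjective⟩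

theorem hom_ne [IsLocalRing R] [IsNoetherianRing R] [Module.Finite R M] [Module.Finite R N]
    [Nontrivial M] [Nontrivial N]
    (h : GG.CousinResolves R (GG.heightFiltration R N) N (fun X => Module.Injective R X))
    (hz : ∀ n (φ : M →ₗ[R] GG.cousinC R (GG.heightFiltration R N) N n), φ = 0) : False := by
  have hs := cousin_ses h.1 (cousin_inj h)
  obtain ⟨π, hπ⟩ := exists_quot (R := R) (M := M)
  have h1 : ∀ n, EV R (R ⧸ IsLocalRing.maximalIdeal R)
      (GG.cousinK R (GG.heightFiltration R N) N n) 0 := by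
    intro n
    rw [EV.zero_iff]
    intro φ
    have h2 := hz n (cj h.1 n ∘ₗ φ ∘ₗ π)
    refine LinearMap.ext fun x => ?_
    obtain ⟨m, hm⟩ := hπ x
    refine (hs n).inj ?_
    have h3 := LinearMap.congr_fun h2 m
    rw [LinearMap.zero_apply, map_zero]
    rw [LinearMap.comp_apply, LinearMap.comp_apply, hm] at h3
    exact h3
  have h2 : ∀ i n, EV R (R ⧸ IsLocalRing.maximalIdeal R)
      (GG.cousinK R (GG.heightFiltration R N) N n) i := by
    intro i
    induction i with
    | zero => exact h1
    | succ i ih =>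
      intro n
      have := h.2.2.2 n
      exact (hs n).cov1 (ih (n + 1)) (EV.of_inj (by omega))
  have hsm : IsLocalRing.maximalIdeal R • (⊤ : Submodule R N) < ⊤ := by
    refine lt_top_iff_ne_top.2 fun h => ?_
    have := Submodule.eq_bot_of_le_smul_of_le_jacobson_bot (IsLocalRing.maximalIdeal R)
      (⊤ : Submodule R N) Module.Finite.fg_top h.ge (IsLocalRing.maximalIdeal_le_jacobson _)
    exact top_ne_bot this
  have hsupp : Module.support R (R ⧸ IsLocalRing.maximalIdeal R) =
      PrimeSpectrum.zeroLocus (IsLocalRing.maximalIdeal R) := by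
    rw [Module.support_eq_zeroLocus, Ideal.annihilator_quotient]
  have hall : ∀ n : ℕ, (n : WithBot ℕ∞) ≤ Module.supportDim R N := by
    intro n
    obtain ⟨rs, hl, hm, hreg⟩ := ModuleCat.exists_isRegular_of_exists_subsingleton_ext
      (IsLocalRing.maximalIdeal R) n N hsm (ModuleCat.of R (R ⧸ IsLocalRing.maximalIdeal R))
      hsupp (fun i _ => h2 i 0)
    have h5 := Module.supportDim_add_length_eq_supportDim_of_isRegular rs hreg
    rw [← h5, hl]
    have : Nontrivial (N ⧸ Ideal.ofList rs • (⊤ : Submodule R N)) := by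
      rw [Submodule.Quotient.nontrivial_iff]
      exact hreg.2.symm
    have h6 : 0 ≤ Module.supportDim R (N ⧸ Ideal.ofList rs • (⊤ : Submodule R N)) := by
      have := Module.supportDim_ne_bot_of_nontrivial R (N ⧸ Ideal.ofList rs • (⊤ : Submodule R N))
      exact Order.krullDim_nonneg_iff.2 (Order.krullDim_ne_bot_iff.1 this)
    exact le_add_of_nonneg_left h6
  have hfin : FiniteRingKrullDim R := inferInstance
  have hlt : ringKrullDim R < ⊤ := ringKrullDim_lt_top
  have hle := Module.supportDim_le_ringKrullDim R N
  generalize ringKrullDim R = x at hlt hle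
  have hall' : ∀ n : ℕ, (n : WithBot ℕ∞) ≤ x := fun n => (hall n).trans hle
  induction x with
  | bot => exact absurd (hall' 0) (by simp)
  | coe x =>
    induction x with
    | top => exact absurd hlt (lt_irrefl _)
    | coe n =>
      have := hall' (n + 1)
      have : n + 1 ≤ n := by exact_mod_cast this
      omega

end
end GP


namespace GP

section
variable {R : Type u} [CommRing R] {M : Type u} [AddCommGroup M] [Module R M]
    {N : ModuleCat.{u} R}

theorem quot_equiv {A B C : Type u} [AddCommGroup A] [Module R A] [AddCommGroup B] [Module R B]
    [AddCommGroup C] [Module R C] (e1 : A →ₗ[R] B) (q0 : B →ₗ[R] C)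
    (hk : LinearMap.range e1 = LinearMap.ker q0) (hq0 : Function.Surjective q0) :
    Nonempty ((B ⧸ LinearMap.range e1) ≃ₗ[R] C) :=
  ⟨(Submodule.quotEquivOfEq _ _ hk).trans (q0.quotKerEquivOfSurjective hq0)⟩

theorem hf_not_le {A : Type u} [AddCommGroup A] [Module R A] {n m : ℕ} {p q : PrimeSpectrum R}
    (hp : p ∈ GG.heightFiltration R A n \ GG.heightFiltration R A (n + 1))
    (hq : q ∈ GG.heightFiltration R A m \ GG.heightFiltration R A (m + 1))
    (hne : q ≠ p) (hnm : n ≤ m) : ¬ q ≤ p := by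
  intro hle
  rw [hf_mem] at hp hq
  have h := htM_lt hq.1 hp.1 (lt_of_le_of_ne hle hne)
  rw [hp.2, hq.2] at h
  have : m + 1 ≤ n := by exact_mod_cast h
  omega

theorem kill_at [IsNoetherianRing R] [Module.Finite R M] [Module.Finite R N]
    (hr : ∀ n, LinearMap.range (GG.cousinTheta R (GG.heightFiltration R N) N n) ≤
      GG.finSupp R (GG.heightFiltration R N n \ GG.heightFiltration R N (n + 1))
        (GG.cousinK R (GG.heightFiltration R N) N n))
    (hl : ∀ n (φ : M →ₗ[R] GG.cousinK R (GG.heightFiltration R N) N (n + 1)),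
      ∃ ψ : M →ₗ[R] GG.cousinC R (GG.heightFiltration R N) N n, cq _ N n ∘ₗ ψ = φ)
    {n m : ℕ} (hnm : n ≤ m) {p : PrimeSpectrum R}
    (hp : p ∈ GG.heightFiltration R (M →ₗ[R] N) n \ GG.heightFiltration R (M →ₗ[R] N) (n + 1))
    (c : M →ₗ[R] GG.cousinC R (GG.heightFiltration R N) N m)
    (h : ∀ r : ↥(GG.heightFiltration R N m \ GG.heightFiltration R N (m + 1)), r.1 = p →
      cmp r c = 0) : ∃ s ∉ p.asIdeal, s • c = 0 := by
  have hsupp : ∀ n, SuppIn (GG.heightFiltration R N n)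
      (GG.cousinK R (GG.heightFiltration R N) N n) :=
    cousin_suppIn (hf_filt N) (by rw [hf_zero]; exact suppIn_support) hr
  refine kill_cmp p c fun r hr0 => ?_
  have h1 := chain hr hl m r.1 r.2 _ hr0
  exact hom_kill_of_not_le (hsupp m) ((hf_filt N).2 m r.1 r.2)
    (hf_not_le hp h1 (fun h' => hr0 (h r h')) hnm) _

theorem main_step [IsNoetherianRing R] [Module.Finite R M] [Module.Finite R N]
    (hr : ∀ n, LinearMap.range (GG.cousinTheta R (GG.heightFiltration R N) N n) ≤
      GG.finSupp R (GG.heightFiltration R N n \ GG.heightFiltration R N (n + 1))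
        (GG.cousinK R (GG.heightFiltration R N) N n))
    (hi : ∀ n, Function.Injective (GG.cousinTheta R (GG.heightFiltration R N) N n))
    (hl : ∀ n (φ : M →ₗ[R] GG.cousinK R (GG.heightFiltration R N) N (n + 1)),
      ∃ ψ : M →ₗ[R] GG.cousinC R (GG.heightFiltration R N) N n, cq _ N n ∘ₗ ψ = φ)
    (n : ℕ) (L : Type u) [AddCommGroup L] [Module R L]
    (ε : L ≃ₗ[R] (M →ₗ[R] GG.cousinK R (GG.heightFiltration R N) N n))
    (S : Set (PrimeSpectrum R))
    (hS : S = GG.heightFiltration R (M →ₗ[R] N) n \ GG.heightFiltration R (M →ₗ[R] N) (n + 1)) :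
    Function.Injective (GG.thetaFull R S L) ∧
    LinearMap.range (GG.thetaFull R S L) ≤ GG.finSupp R S L ∧
    Nonempty ((M →ₗ[R] GG.cousinC R (GG.heightFiltration R N) N n) ≃ₗ[R] GG.finSupp R S L) ∧
    Nonempty (GG.nextKType R S L ≃ₗ[R]
      (M →ₗ[R] GG.cousinK R (GG.heightFiltration R N) N (n + 1))) := by
  subst hS
  have hs := cousin_ses hr hi
  let e0 : (M →ₗ[R] GG.cousinK R (GG.heightFiltration R N) N n) →ₗ[R]
      (M →ₗ[R] GG.cousinC R (GG.heightFiltration R N) N n) :=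
    LinearMap.llcomp R M _ _ (cj hr n)
  let q0 : (M →ₗ[R] GG.cousinC R (GG.heightFiltration R N) N n) →ₗ[R]
      (M →ₗ[R] GG.cousinK R (GG.heightFiltration R N) N (n + 1)) :=
    LinearMap.llcomp R M _ _ (cq _ N n)
  have he0 : Function.Injective e0 := by
    intro a b hab
    refine LinearMap.ext fun m => (hs n).inj ?_
    exact LinearMap.congr_fun hab m
  have hex : ∀ c, q0 c = 0 → ∃ k, e0 k = c := by
    intro c hc
    have h1 : ∀ m, ∃ x, cj hr n x = c m := fun m =>
      ((hs n).exact (c m)).1 (LinearMap.congr_fun hc m)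
    let J := LinearEquiv.ofInjective (cj hr n) (hs n).inj
    refine ⟨J.symm.toLinearMap ∘ₗ LinearMap.codRestrict _ c h1, LinearMap.ext fun m => ?_⟩
    change (J (J.symm ⟨c m, h1 m⟩)).1 = c m
    rw [LinearEquiv.apply_symm_apply]
  have hex' : ∀ k, q0 (e0 k) = 0 := by
    intro k
    refine LinearMap.ext fun m => ?_
    exact (hs n).exact.apply_apply_eq_zero (k m)
  let e1 : L →ₗ[R] (M →ₗ[R] GG.cousinC R (GG.heightFiltration R N) N n) :=
    e0 ∘ₗ ε.toLinearMap
  have he : Function.Injective e1 := he0.comp ε.injective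
  have hstep := step (K := L) (C := M →ₗ[R] GG.cousinC R (GG.heightFiltration R N) N n)
    (GG.heightFiltration R (M →ₗ[R] N) n \ GG.heightFiltration R (M →ₗ[R] N) (n + 1))
    e1 he
  obtain ⟨E, hE⟩ := hstep
    (by
      intro p hp c
      obtain ⟨u, hu, h⟩ := kill_at hr hl (Nat.le_succ n) hp (cj hr (n + 1) ∘ₗ q0 c) (by
        intro r hrp
        by_contra hne
        have h1 := chain hr hl (n + 1) r.1 r.2 _ hne
        rw [hrp, hf_mem] at h1
        rw [hf_mem, h1.2] at hp
        exact absurd (by exact_mod_cast hp.2 : n + 1 = n) (by omega))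
      have h2 : q0 (u • c) = 0 := by
        rw [map_smul]
        refine LinearMap.ext fun m => (hs (n + 1)).inj ?_
        rw [LinearMap.smul_apply, map_smul, LinearMap.zero_apply, map_zero]
        exact LinearMap.congr_fun h m
      obtain ⟨k, hk⟩ := hex _ h2
      refine ⟨u, hu, ε.symm k, ?_⟩
      change u • c = e0 (ε (ε.symm k))
      rw [LinearEquiv.apply_symm_apply, hk])
    (by
      intro c hc
      have : ∃ r, cmp r c ≠ 0 := by
        by_contra! h
        exact hc (cmp_ext h)
      obtain ⟨r, hr0⟩ := this
      refine ⟨r.1, chain hr hl n r.1 r.2 _ hr0, fun u hu h => hr0 (hom_loc_inj hu ?_)⟩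
      rw [← map_smul, h, map_zero])
    (by
      intro c
      refine Set.Finite.subset (((cmp_finite c).image Subtype.val).preimage
        (f := Subtype.val) Subtype.val_injective.injOn) ?_
      intro p hp
      by_contra hn
      obtain ⟨s, hs1, h⟩ := kill_at hr hl le_rfl p.2 c (by
        intro r hrp
        by_contra hne
        exact hn ⟨r, hne, hrp⟩)
      exact hp s hs1 h)
    (by
      intro p hp c u hu
      by_cases hpN : p ∈ GG.heightFiltration R N n \ GG.heightFiltration R N (n + 1)
      · obtain ⟨z', hz'⟩ := hom_loc_div hu (cmp (⟨p, hpN⟩ :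
          ↥(GG.heightFiltration R N n \ GG.heightFiltration R N (n + 1))) c)
        obtain ⟨c', h1, h2⟩ := exists_cmp (⟨p, hpN⟩ :
          ↥(GG.heightFiltration R N n \ GG.heightFiltration R N (n + 1))) z'
        refine ⟨c', kill_at hr hl le_rfl hp _ ?_, fun p' hp' hne =>
          kill_at hr hl le_rfl hp' _ ?_⟩
        · intro r hrp
          obtain rfl : r = ⟨p, hpN⟩ := Subtype.ext hrp
          rw [map_sub, map_smul, h1, hz', sub_self]
        · intro r hrp
          refine h2 r ?_
          rintro rfl
          exact hne hrp.symm
      · refine ⟨0, kill_at hr hl le_rfl hp _ ?_, fun p' hp' hne =>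
          ⟨1, fun h => p'.2.ne_top ((Ideal.eq_top_iff_one _).2 h), smul_zero _⟩⟩
        intro r hrp
        exact absurd (hrp ▸ r.2) hpN)
  obtain ⟨h1, h2, ⟨Q⟩⟩ := step_cons (K := L)
    (C := M →ₗ[R] GG.cousinC R (GG.heightFiltration R N) N n) _ e1 he E hE
  have hk : LinearMap.range e1 = LinearMap.ker q0 := by
    ext c
    constructor
    · rintro ⟨k, rfl⟩
      exact hex' _
    · intro hc
      obtain ⟨k, hk⟩ := hex c hc
      refine ⟨ε.symm k, ?_⟩
      change e0 (ε (ε.symm k)) = c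
      rw [LinearEquiv.apply_symm_apply, hk]
  have hq0 : Function.Surjective q0 := fun φ => hl n φ
  obtain ⟨Q1⟩ := quot_equiv (A := L) (B := M →ₗ[R] GG.cousinC R (GG.heightFiltration R N) N n)
    (C := M →ₗ[R] GG.cousinK R (GG.heightFiltration R N) N (n + 1)) e1 q0 hk hq0
  exact ⟨h1, h2, ⟨E⟩, ⟨Q.symm.trans Q1⟩⟩

theorem main [IsLocalRing R] [IsNoetherianRing R] [Module.Finite R M]
    (hR : GG.IsCMLocalRing R) (hN : GG.IsGorensteinModule R N)
    (hM : GG.IsMaximalCM R M) (hG : ∃ n, GG.gfdLE R M n) :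
    GG.IsGGorenstein R (ModuleCat.of R (M →ₗ[R] N)) := by
  obtain ⟨⟨x, hx⟩, hNf, h⟩ := hN
  have hNn : Nontrivial N := ⟨x, 0, hx⟩
  have hMn : Nontrivial M := by
    by_contra hn
    rw [not_nontrivial_iff_subsingleton] at hn
    have h2 := hM.2
    have h3 : GG.mdim R M = ⊥ := Module.supportDim_eq_bot_of_subsingleton R M
    rw [h3] at h2
    exact absurd h2.symm (ringKrullDim_ne_bot)
  have hi := cousin_inj h
  have hs := cousin_ses h.1 hi
  have hl : ∀ n (φ : M →ₗ[R] GG.cousinK R (GG.heightFiltration R N) N (n + 1)),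
      ∃ ψ : M →ₗ[R] GG.cousinC R (GG.heightFiltration R N) N n, cq _ N n ∘ₗ ψ = φ :=
    fun n φ => (hs n).lift (ev_K hR hM h n 1 one_pos) φ
  have hne : ∃ x : M →ₗ[R] N, x ≠ 0 := by
    by_contra! hz
    refine hom_ne (M := M) h fun n φ => cmp_ext fun r => ?_
    by_contra hr0
    have h1 := (hf_mem.1 (chain h.1 hl n r.1 r.2 _ hr0)).1
    have : Subsingleton (M →ₗ[R] N) := ⟨fun a b => by rw [hz a, hz b]⟩
    rw [Module.support_eq_empty] at h1
    exact h1
  have hε : ∀ n, Nonempty (GG.cousinK R (GG.heightFiltration R (M →ₗ[R] N))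
      (ModuleCat.of R (M →ₗ[R] N)) n ≃ₗ[R]
      (M →ₗ[R] GG.cousinK R (GG.heightFiltration R N) N n)) := by
    intro n
    induction n with
    | zero => exact ⟨LinearEquiv.refl R (M →ₗ[R] N)⟩
    | succ n ih =>
      obtain ⟨ε⟩ := ih
      exact (main_step h.1 hi hl n _ ε _ rfl).2.2.2
  refine ⟨hne, inferInstanceAs (Module.Finite R (M →ₗ[R] N)), ?_⟩
  refine cousin_of_inj (fun n => ?_) (fun n => ?_) (fun n => ?_)
  · obtain ⟨ε⟩ := hε n
    exact (main_step h.1 hi hl n _ ε _ rfl).2.1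
  · obtain ⟨ε⟩ := hε n
    exact (main_step h.1 hi hl n _ ε _ rfl).1
  · obtain ⟨ε⟩ := hε n
    obtain ⟨E⟩ := (main_step h.1 hi hl n _ ε _ rfl).2.2.1
    exact ((a10 hR hM hG (h.2.2.2 n)).congr E).gi

end
end GP

open GG in
/-- If `N` is a Gorenstein module and `M` is maximal Cohen–Macaulay of finite Gorenstein
flat dimension, then `Hom_R(M, N)` is G–Gorenstein. -/
theorem stmt14 (R : Type u) [CommRing R] [IsLocalRing R] [IsNoetherianRing R]
    (hCM : IsCMLocalRing R) (hR : HasDualizingComplex R)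
    (N : ModuleCat.{u} R) (hN : IsGorensteinModule R N)
    (M : ModuleCat.{u} R) (hMf : Module.Finite R M) (hMCM : IsMaximalCM R M)
    (hGfd : ∃ n, gfdLE R M n) :
    IsGGorenstein R (ModuleCat.of R (M →ₗ[R] N)) := by
  exact GP.main hCM hN hMCM hGfd
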